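/- arXiv:2602.15665 — 8 statements merged into one kernel-verified Lean document; each statement's English description precedes it below -/
import Mathlib

section
/- Let 0 < α < 1/2 and define u_α : ℝ² \ {0} → ℝ by u_α(x) = (−log|x|)^α for 0 < |x| ≤ 1/e and u_α(x) = 1 for |x| > 1/e. Then ∫_{0<|x|≤1/e} |∇u_α(x)|² dx < ∞, while for every b ≤ 1 + 2α one has ∫_{0<|x|<1/e} u_α(x)² / (|x|² |log|x||^b) dx = +∞. In particular, the weighted Hardy inequality ∫_{|x|<1/e} |u|²/(|x|²|log|x||^b) dx ≤ c Q_A[u] with an exponent b < 2 fails for functions that are merely locally H¹ near the origin. -/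
open MeasureTheory Real Filter Set
open scoped ENNReal Topology

noncomputable section

/-- The Euclidean plane `ℝ²`. -/
abbrev E2 : Type := EuclideanSpace ℝ (Fin 2)

/-- The point of `ℝ²` with the given coordinates. -/
def mk2 (a b : ℝ) : E2 := (WithLp.equiv 2 (Fin 2 → ℝ)).symm ![a, b]

/-- Partial derivative of a real-valued function on `ℝ²`. -/
def pdR (i : Fin 2) (f : E2 → ℝ) (x : E2) : ℝ :=
  fderiv ℝ f x (EuclideanSpace.single i 1)

/-- Partial derivative of a complex-valued function on `ℝ²`. -/
def pdC (i : Fin 2) (u : E2 → ℂ) (x : E2) : ℂ :=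
  fderiv ℝ u x (EuclideanSpace.single i 1)

/-- The magnetic energy density `|i∇u(x) + A(x)u(x)|²`. -/
def magDen (A : E2 → E2) (u : E2 → ℂ) (x : E2) : ℝ :=
  ‖Complex.I * pdC 0 u x + (A x 0 : ℂ) * u x‖ ^ 2
  + ‖Complex.I * pdC 1 u x + (A x 1 : ℂ) * u x‖ ^ 2

/-- The magnetic Dirichlet form `Q_A[u] = ∫_{ℝ²} |i∇u + Au|² dx`. -/
def magQ (A : E2 → E2) (u : E2 → ℂ) : ℝ := ∫ x, magDen A u x

/-- The weight `ρ₀(x) = 1/(|x|²(1 + (log|x|)²))`. -/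
def rho0 (x : E2) : ℝ := 1 / (‖x‖ ^ 2 * (1 + Real.log ‖x‖ ^ 2))

/-- Smooth compactly supported test functions on `ℝ²`. -/
def IsTest {F : Type*} [NormedAddCommGroup F] [NormedSpace ℝ F] (u : E2 → F) : Prop :=
  ContDiff ℝ (⊤ : ℕ∞) u ∧ HasCompactSupport u

/-- Membership in `L^p_loc(ℝ²)`. -/
def MemLpLoc (p : ℝ) (f : E2 → ℝ) : Prop :=
  ∀ K : Set E2, IsCompact K → IntegrableOn (fun x => |f x| ^ p) K volume

/-- `A` has distributional curl equal to `B`: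
`∫ B φ = ∫ (A₁ ∂₂φ − A₂ ∂₁φ)` for all test functions `φ`. -/
def HasDistribCurl (A : E2 → E2) (B : E2 → ℝ) : Prop :=
  ∀ φ : E2 → ℝ, IsTest φ →
    ∫ x, B x * φ x = ∫ x, (A x 0 * pdR 1 φ x - A x 1 * pdR 0 φ x)

/-- The Poincaré gauge `A(x) = (−x₂, x₁) ∫₀¹ B(tx) t dt` of a magnetic field `B`. -/
def poincareGauge (B : E2 → ℝ) (x : E2) : E2 :=
  (∫ t in (0:ℝ)..1, B (t • x) * t) • mk2 (-(x 1)) (x 0)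

/-- The normalized flux `α(r) = (1/2π) ∫_{|x|<r} B dx`. -/
def flux (B : E2 → ℝ) (r : ℝ) : ℝ :=
  (1 / (2 * π)) * ∫ x in Metric.ball (0 : E2) r, B x

/-- `Φ(r) = α(r)/r`. -/
def Phi (B : E2 → ℝ) (r : ℝ) : ℝ := flux B r / r

/-- A power of `-log r` below the critical exponent, divided by `r`, is integrable at `0`. -/
lemma integrableOn_rpow_neg_log_div {s : ℝ} (hs : s < -1) :
    IntegrableOn (fun r : ℝ => (-Real.log r) ^ s / r) (Ioo 0 (Real.exp 1)⁻¹) := by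
  have hlog : ∀ r ∈ Ioc (0 : ℝ) (Real.exp 1)⁻¹, 0 < -Real.log r := fun r hr => by
    have := Real.log_le_log hr.1 hr.2
    rw [Real.log_inv, Real.log_exp] at this
    linarith
  have hderiv : ∀ r ∈ Ioc (0 : ℝ) (Real.exp 1)⁻¹,
      HasDerivAt (fun r : ℝ => (-Real.log r) ^ (s + 1) / (-(s + 1)))
        ((-Real.log r) ^ s / r) r := fun r hr => by
    have h := (((Real.hasDerivAt_log hr.1.ne').fun_neg).rpow_const (p := s + 1)
      (Or.inl (hlog r hr).ne')).div_const (-(s + 1))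
    refine h.congr_deriv ?_
    have h1 : s + 1 ≠ 0 := by linarith
    have := hr.1.ne'
    rw [add_sub_cancel_right]
    field_simp
  refine (intervalIntegral.integrableOn_deriv_of_nonneg (a := 0) (b := (Real.exp 1)⁻¹)
    (g := fun r : ℝ => (-Real.log r) ^ (s + 1) / (-(s + 1))) ?_
    (fun r hr => hderiv r ⟨hr.1, hr.2.le⟩) ?_).mono_set Ioo_subset_Ioc_self
  · intro r hr
    rcases hr.1.eq_or_lt with rfl | h0
    · have h1 : Tendsto (fun r : ℝ => (-Real.log r) ^ (s + 1) / (-(s + 1))) (𝓝[≠] 0) (𝓝 0) := by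
        have h2 : Tendsto (fun r : ℝ => -Real.log r) (𝓝[≠] 0) atTop :=
          tendsto_neg_atBot_atTop.comp Real.tendsto_log_nhdsNE_zero
        have h3 := (tendsto_rpow_neg_atTop (y := -(s + 1)) (by linarith)).comp h2
        simpa [Function.comp_def] using h3.div_const (-(s + 1))
      refine (continuousAt_iff_punctured_nhds.2 ?_).continuousWithinAt
      simpa [Real.zero_rpow (show s + 1 ≠ 0 by linarith)] using h1
    · exact (hderiv r ⟨h0, hr.2⟩).continuousAt.continuousWithinAt
  · intro r hr
    exact div_nonneg (Real.rpow_nonneg (hlog r ⟨hr.1, hr.2.le⟩).le _) hr.1.le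

/-- At or above the critical exponent `-1`, the function `(-log r) ^ s / r` is not integrable
at `0`. -/
lemma not_integrableOn_rpow_neg_log_div {s : ℝ} (hs : -1 ≤ s) :
    ¬ IntegrableOn (fun r : ℝ => (-Real.log r) ^ s / r) (Ioo 0 (Real.exp 1)⁻¹) := by
  have hmem : Ioo (0 : ℝ) (Real.exp 1)⁻¹ ∈ 𝓝[>] (0 : ℝ) := Ioo_mem_nhdsGT (by positivity)
  have hlog : ∀ r ∈ Ioo (0 : ℝ) (Real.exp 1)⁻¹, 1 < -Real.log r := fun r hr => by
    have := Real.log_lt_log hr.1 hr.2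
    rw [Real.log_inv, Real.log_exp] at this
    linarith
  have hderiv : ∀ r ∈ Ioo (0 : ℝ) (Real.exp 1)⁻¹,
      HasDerivAt (fun r : ℝ => Real.log (-Real.log r)) (-r⁻¹ / (-Real.log r)) r := fun r hr =>
    ((Real.hasDerivAt_log hr.1.ne').fun_neg).log (by linarith [hlog r hr] : 0 < -Real.log r).ne'
  refine not_integrableOn_of_tendsto_norm_atTop_of_deriv_isBigO_filter
    (f := fun r : ℝ => Real.log (-Real.log r)) (𝓝[>] 0) hmem ?_ ?_ ?_
  · filter_upwards [hmem] with r hr using (hderiv r hr).differentiableAt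
  · exact tendsto_norm_atTop_atTop.comp (Real.tendsto_log_atTop.comp
      (tendsto_neg_atBot_atTop.comp Real.tendsto_log_nhdsGT_zero))
  · refine Asymptotics.IsBigO.of_bound 1 ?_
    filter_upwards [hmem] with r hr
    have hl := hlog r hr
    have hr0 := hr.1
    have hle : (-Real.log r)⁻¹ ≤ (-Real.log r) ^ s := by
      rw [← Real.rpow_neg_one]
      exact Real.rpow_le_rpow_of_exponent_le hl.le hs
    rw [(hderiv r hr).deriv, one_mul, norm_div, norm_neg, norm_inv, norm_div,
      Real.norm_of_nonneg hr0.le, Real.norm_of_nonneg (by linarith : 0 ≤ -Real.log r),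
      Real.norm_of_nonneg (Real.rpow_nonneg (by linarith) _), div_eq_mul_inv, div_eq_mul_inv,
      mul_comm]
    gcongr

/-- A radial function on the plane with profile `(-log r) ^ s / r ^ 2` is integrable on the disc of
radius `1/e` exactly when `(-log r) ^ s / r` is integrable on `(0, 1/e)`. -/
lemma integrableOn_ball_rpow_neg_log_div_sq {s : ℝ} :
    IntegrableOn (fun x : E2 => (-Real.log ‖x‖) ^ s / ‖x‖ ^ 2)
      (Metric.ball 0 (Real.exp 1)⁻¹) ↔
    IntegrableOn (fun r : ℝ => (-Real.log r) ^ s / r) (Ioo 0 (Real.exp 1)⁻¹) := by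
  rw [integrableOn_fun_norm_addHaar (volume : Measure E2)
    (f := fun r : ℝ => (-Real.log r) ^ s / r ^ 2)]
  refine integrableOn_congr_fun (fun r hr => ?_) measurableSet_Ioo
  have := hr.1.ne'
  simp only [finrank_euclideanSpace, Fintype.card_fin, smul_eq_mul, Nat.add_one_sub_one, pow_one]
  field_simp

/-- The gradient of the radial function `(-log ‖x‖) ^ α` is bounded by the derivative of its
profile. -/
lemma norm_fderiv_rpow_neg_log_norm_le {E : Type*} [NormedAddCommGroup E] [InnerProductSpace ℝ E]
    {α : ℝ} {x : E} (hx : x ≠ 0) (hlog : 0 < -Real.log ‖x‖) :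
    ‖fderiv ℝ (fun y : E => (-Real.log ‖y‖) ^ α) x‖ ≤
      |α| * (-Real.log ‖x‖) ^ (α - 1) / ‖x‖ := by
  have hn : 0 < ‖x‖ := norm_pos_iff.2 hx
  have hdiff : HasFDerivAt (fun y : E => ‖y‖) (fderiv ℝ (fun y : E => ‖y‖) x) x :=
    (differentiableAt_id.norm ℝ hx).hasFDerivAt
  have h := (((Real.hasDerivAt_log hn.ne').fun_neg).rpow_const (p := α)
    (Or.inl hlog.ne')).comp_hasFDerivAt x hdiff
  have hle : ‖fderiv ℝ (fun y : E => ‖y‖) x‖ ≤ 1 := by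
    simpa using norm_fderiv_le_of_lipschitz ℝ (x₀ := x) (lipschitzWith_one_norm (E := E))
  have hfd : fderiv ℝ (fun y : E => (-Real.log ‖y‖) ^ α) x = _ := h.fderiv
  rw [hfd, norm_smul]
  refine (mul_le_of_le_one_right (norm_nonneg _) hle).trans_eq ?_
  rw [norm_mul, norm_mul, norm_neg, norm_inv, norm_norm,
    Real.norm_of_nonneg (Real.rpow_nonneg hlog.le _), Real.norm_eq_abs]
  ring

/-- **Optimality of the logarithmic power at zero.**
For `0 < α < 1/2`, the radial function `u_α(x) = (−log|x|)^α` (for `0 < |x| ≤ 1/e`, and `= 1`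
outside) has square-integrable gradient near the origin, while
`∫ u_α²/(|x|²|log|x||^b) dx = ∞` for every `b ≤ 1 + 2α`. -/
theorem optimality_at_zero (α : ℝ) (hα0 : 0 < α) (hα : α < 1 / 2)
    (uα : E2 → ℝ)
    (huα : ∀ x : E2, uα x = if ‖x‖ ≤ (Real.exp 1)⁻¹ then (-Real.log ‖x‖) ^ α else 1) :
    (∫⁻ x in {x : E2 | 0 < ‖x‖ ∧ ‖x‖ ≤ (Real.exp 1)⁻¹},
        ENNReal.ofReal (‖fderiv ℝ uα x‖ ^ 2) < ⊤) ∧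
    (∀ b : ℝ, b ≤ 1 + 2 * α →
      ∫⁻ x in {x : E2 | 0 < ‖x‖ ∧ ‖x‖ < (Real.exp 1)⁻¹},
        ENNReal.ofReal (uα x ^ 2 / (‖x‖ ^ 2 * |Real.log ‖x‖| ^ b)) = ⊤) := by
  have hlog : ∀ x : E2, 0 < ‖x‖ → ‖x‖ < (Real.exp 1)⁻¹ → 0 < -Real.log ‖x‖ := fun x h0 h1 => by
    have := Real.log_lt_log h0 h1
    rw [Real.log_inv, Real.log_exp] at this
    linarith
  have hball : MeasurableSet (Metric.ball (0 : E2) (Real.exp 1)⁻¹) := measurableSet_ball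
  have hne : ∀ᵐ x : E2, x ≠ 0 := by simp [ae_iff]
  have hS : {x : E2 | 0 < ‖x‖ ∧ ‖x‖ < (Real.exp 1)⁻¹} =ᵐ[volume]
      Metric.ball (0 : E2) (Real.exp 1)⁻¹ := by
    refine eventuallyEq_set.2 ?_
    filter_upwards [hne] with x hx
    simp [hx]
  have hT : {x : E2 | 0 < ‖x‖ ∧ ‖x‖ ≤ (Real.exp 1)⁻¹} =ᵐ[volume]
      Metric.ball (0 : E2) (Real.exp 1)⁻¹ := by
    have hsphere : ∀ᵐ x : E2, x ∉ Metric.sphere (0 : E2) (Real.exp 1)⁻¹ :=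
      measure_eq_zero_iff_ae_notMem.1 (Measure.addHaar_sphere _ _ _)
    refine eventuallyEq_set.2 ?_
    filter_upwards [hne, hsphere] with x hx hx'
    rw [mem_sphere_zero_iff_norm] at hx'
    simp [hx, le_iff_lt_or_eq, hx']
  constructor
  · rw [setLIntegral_congr hT]
    have hint : IntegrableOn (fun x : E2 => α ^ 2 * ((-Real.log ‖x‖) ^ (2 * α - 2) / ‖x‖ ^ 2))
        (Metric.ball 0 (Real.exp 1)⁻¹) :=
      (integrableOn_ball_rpow_neg_log_div_sq.2
        (integrableOn_rpow_neg_log_div (by linarith))).const_mul _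
    refine lt_of_le_of_lt (lintegral_mono_ae ?_) hint.lintegral_lt_top
    filter_upwards [ae_restrict_mem hball, ae_restrict_of_ae hne] with x hx hx0
    have hn : 0 < ‖x‖ := norm_pos_iff.2 hx0
    have hl := hlog x hn (mem_ball_zero_iff.1 hx)
    have heq : uα =ᶠ[𝓝 x] fun y => (-Real.log ‖y‖) ^ α := by
      filter_upwards [Metric.isOpen_ball.mem_nhds hx] with y hy
      rw [huα, if_pos (mem_ball_zero_iff.1 hy).le]
    refine ENNReal.ofReal_le_ofReal ?_
    rw [heq.fderiv_eq]
    refine (pow_le_pow_left₀ (norm_nonneg _)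
      (norm_fderiv_rpow_neg_log_norm_le hx0 hl) 2).trans_eq ?_
    rw [div_pow, mul_pow, sq_abs, ← Real.rpow_mul_natCast hl.le, mul_div_assoc]
    congr 4
    push_cast
    ring
  · intro b hb
    rw [setLIntegral_congr hS]
    have hcongr : ∀ᵐ x ∂(volume.restrict (Metric.ball (0 : E2) (Real.exp 1)⁻¹)),
        uα x ^ 2 / (‖x‖ ^ 2 * |Real.log ‖x‖| ^ b) =
          (-Real.log ‖x‖) ^ (2 * α - b) / ‖x‖ ^ 2 ∧
        0 ≤ (-Real.log ‖x‖) ^ (2 * α - b) / ‖x‖ ^ 2 := by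
      filter_upwards [ae_restrict_mem hball, ae_restrict_of_ae hne] with x hx hx0
      have hn : 0 < ‖x‖ := norm_pos_iff.2 hx0
      have hl := hlog x hn (mem_ball_zero_iff.1 hx)
      refine ⟨?_, by positivity⟩
      rw [huα, if_pos (mem_ball_zero_iff.1 hx).le, ← abs_neg, abs_of_pos hl,
        Real.rpow_sub hl, ← Real.rpow_mul_natCast hl.le, Nat.cast_ofNat, mul_comm α 2, div_div,
        mul_comm (‖x‖ ^ 2)]
    rw [lintegral_congr_ae (hcongr.mono fun x hx => congrArg ENNReal.ofReal hx.1)]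
    by_contra hfin
    have hmeas : Measurable fun x : E2 => (-Real.log ‖x‖) ^ (2 * α - b) / ‖x‖ ^ 2 := by
      fun_prop
    exact not_integrableOn_rpow_neg_log_div (by linarith)
      (integrableOn_ball_rpow_neg_log_div_sq.1 ((lintegral_ofReal_ne_top_iff_integrable
        hmeas.aestronglyMeasurable (hcongr.mono fun x hx => hx.2)).1 hfin))

end
end

section
/- Let 0 < R < r₀. Then there exists a constant C > 0, depending only on R and r₀, such that for every u ∈ C¹(ℝ²; ℝ) one has ∫_{|x|≤R} u(x)² / (|x|² (log(|x|/r₀))²) dx ≤ C ( ∫_{|x|≤R} |∇u(x)|² dx + ∫_{|x|≤R} u(x)² dx ). -/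
open MeasureTheory Real Filter Set
open scoped ENNReal Topology

noncomputable section

/-- The primitive `-1 / log (r / r₀)` of the radial weight `1 / (r (log (r / r₀))²)`. -/
theorem hasDerivAt_neg_inv_log_div {r r₀ : ℝ} (hr : 0 < r) (hrr : r < r₀) :
    HasDerivAt (fun s => -(Real.log (s / r₀))⁻¹) (1 / (r * Real.log (r / r₀) ^ 2)) r := by
  have h₀ : 0 < r₀ := hr.trans hrr
  have hlog : Real.log (r / r₀) ≠ 0 :=
    (Real.log_neg (div_pos hr h₀) ((div_lt_one h₀).2 hrr)).ne
  have h1 : HasDerivAt (fun s : ℝ => s / r₀) (1 / r₀) r := (hasDerivAt_id r).div_const r₀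
  have h2 := ((h1.log (div_pos hr h₀).ne').fun_inv hlog).fun_neg
  convert! h2 using 1
  field_simp

theorem continuousOn_neg_inv_log_div {R r₀ : ℝ} (hR : 0 < R) (hRr : R < r₀) :
    ContinuousOn (fun s => -(Real.log (s / r₀))⁻¹) (Icc 0 R) := by
  have h₀ : 0 < r₀ := hR.trans hRr
  intro s hs
  rcases hs.1.eq_or_lt with rfl | hs0
  · have hdiv : Tendsto (fun s : ℝ => s / r₀) (𝓝[>] 0) (𝓝[>] 0) := by
      refine tendsto_nhdsWithin_iff.2 ⟨?_, ?_⟩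
      · have : ContinuousAt (fun s : ℝ => s / r₀) 0 := by fun_prop
        simpa [ContinuousAt] using! this.tendsto.mono_left nhdsWithin_le_nhds
      · filter_upwards [self_mem_nhdsWithin] with t ht using div_pos ht h₀
    have h := (tendsto_inv_atBot_zero.comp (tendsto_log_nhdsGT_zero.comp hdiv)).neg
    have h' : ContinuousWithinAt (fun s => -(Real.log (s / r₀))⁻¹) (Ioi 0) 0 := by
      simpa [ContinuousWithinAt, Function.comp_def] using! h
    exact (continuousWithinAt_Ioi_iff_Ici.1 h').mono fun x hx => hx.1
  · exact (hasDerivAt_neg_inv_log_div hs0 (hs.2.trans_lt hRr)).continuousAt.continuousWithinAt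

theorem integrableOn_inv_mul_log_sq {R r₀ : ℝ} (hR : 0 < R) (hRr : R < r₀) :
    IntegrableOn (fun r => 1 / (r * Real.log (r / r₀) ^ 2)) (Ioc 0 R) :=
  intervalIntegral.integrableOn_deriv_of_nonneg (continuousOn_neg_inv_log_div hR hRr)
    (fun _ hr => hasDerivAt_neg_inv_log_div hr.1 (hr.2.trans hRr))
    fun r hr => by have := hr.1; positivity

/-- One-dimensional Hardy inequality with logarithmic weight. -/
theorem integral_sq_mul_log_weight_le {R r₀ : ℝ} (hR : 0 < R) (hRr : R < r₀) {k : ℝ}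
    (hk : k = -(Real.log (R / r₀))⁻¹ / R ^ 2) {f f' g : ℝ → ℝ}
    (hf : ∀ r, HasDerivAt f (f' r) r) (hg : Continuous g) (hfg : ∀ r, |f' r| ≤ g r) :
    ∫ r in 0..R, f r ^ 2 * (1 / (r * Real.log (r / r₀) ^ 2)) ≤
      (6 * k + 4 + 2 * k * R ^ 2) * ∫ r in 0..R, r * (g r ^ 2 + f r ^ 2) := by
  have h₀ : 0 < r₀ := hR.trans hRr
  have hfc : Continuous f := continuous_iff_continuousAt.2 fun r => (hf r).continuousAt
  have hk0 : 0 ≤ k := by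
    have := Real.log_neg (div_pos hR h₀) ((div_lt_one h₀).2 hRr)
    rw [hk]
    have := inv_neg''.2 this
    exact div_nonneg (by linarith) (by positivity)
  set c := 6 * k + 4 + 2 * k * R ^ 2 with hc
  set w : ℝ → ℝ := fun r => 1 / (r * Real.log (r / r₀) ^ 2) with hw
  have hwi : IntervalIntegrable (fun r => f r ^ 2 * w r) volume 0 R := by
    have : IntervalIntegrable w volume 0 R :=
      (intervalIntegrable_iff_integrableOn_Ioc_of_le hR.le).2 (integrableOn_inv_mul_log_sq hR hRr)
    exact this.continuousOn_mul (by fun_prop)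
  have hgi : IntervalIntegrable (fun r => r * (g r ^ 2 + f r ^ 2)) volume 0 R :=
    Continuous.intervalIntegrable (by fun_prop) _ _
  have hi := (hwi.const_mul (1 / 2)).sub (hgi.const_mul (c / 2))
  set H : ℝ → ℝ := fun r => -(Real.log (r / r₀))⁻¹ - k * r ^ 2 with hH
  have hHc : ContinuousOn H (Icc 0 R) :=
    (continuousOn_neg_inv_log_div hR hRr).sub (by fun_prop)
  have hHd : ∀ r ∈ Ioo 0 R, HasDerivAt H (w r - k * (2 * r)) r := fun r hr => by
    have h1 := hasDerivAt_neg_inv_log_div hr.1 (hr.2.trans hRr)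
    have h2 : HasDerivAt (fun s => k * s ^ 2) (k * (2 * r)) r := by
      simpa using (hasDerivAt_pow 2 r).const_mul k
    exact h1.sub h2
  have key := intervalIntegral.integral_le_sub_of_hasDeriv_right_of_le hR.le
    (g := fun r => H r * f r ^ 2)
    (g' := fun r => (w r - k * (2 * r)) * f r ^ 2 + H r * (2 * f r * f' r))
    (φ := fun r => 1 / 2 * (f r ^ 2 * w r) - c / 2 * (r * (g r ^ 2 + f r ^ 2)))
    (hHc.mul (by fun_prop))
    (fun r hr => by
      have h2 := (hf r).fun_pow 2
      have := (hHd r hr).fun_mul h2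
      simpa using! this.hasDerivWithinAt)
    ((intervalIntegrable_iff_integrableOn_Icc_of_le hR.le).1 hi)
    (fun r hr => by
      have hr0 := hr.1
      have hlog : Real.log (r / r₀) ≠ 0 :=
        (Real.log_neg (div_pos hr0 h₀) ((div_lt_one h₀).2 (hr.2.trans hRr))).ne
      have hgf : f' r ^ 2 ≤ g r ^ 2 := sq_le_sq.2 ((hfg r).trans (le_abs_self _))
      set l := Real.log (r / r₀)
      have hwr : w r = r * (l⁻¹ / r) ^ 2 := by
        change 1 / (r * l ^ 2) = _
        field_simp
      have hl : l⁻¹ = r * (l⁻¹ / r) := by field_simp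
      simp only [hH]
      rw [hwr]
      change _ ≤ _ + (-l⁻¹ - k * r ^ 2) * _
      generalize hm : l⁻¹ / r = m at *
      rw [hl]
      have e1 : 0 ≤ r * (m * f r - 2 * f' r) ^ 2 := by positivity
      have e2 : 0 ≤ k * r * (f r - r * f' r) ^ 2 := by positivity
      have e3 : k * r * (r ^ 2 * f' r ^ 2) ≤ k * r * (R ^ 2 * g r ^ 2) := by
        have := hr.2.le
        gcongr
      have e4 : r * f' r ^ 2 ≤ r * g r ^ 2 := by gcongr
      have e5 : 0 ≤ k * r * g r ^ 2 := by positivity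
      have e6 : 0 ≤ r * f r ^ 2 := by positivity
      have e7 : 0 ≤ k * R ^ 2 * (r * f r ^ 2) := by positivity
      rw [hc]
      nlinarith)
  rw [intervalIntegral.integral_sub (hwi.const_mul _) (hgi.const_mul _),
    intervalIntegral.integral_const_mul, intervalIntegral.integral_const_mul] at key
  have hHR : H R = 0 := by
    simp only [hH, hk]
    field_simp
    ring
  have hH0 : H 0 = 0 := by simp [hH]
  simp only [hHR, hH0] at key
  linarith

/-- The unit vector of the plane with polar angle `θ`. -/
def unitVec (θ : ℝ) : E2 :=
  Complex.orthonormalBasisOneI.repr (Real.cos θ + Real.sin θ * Complex.I)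

theorem norm_unitVec (θ : ℝ) : ‖unitVec θ‖ = 1 := by
  rw [unitVec, LinearIsometryEquiv.norm_map]
  push_cast
  exact Complex.norm_cos_add_sin_mul_I θ

theorem continuous_unitVec : Continuous unitVec := by
  unfold unitVec
  fun_prop

theorem lintegral_eq_lintegral_polar {F : E2 → ℝ≥0∞} (hF : Measurable F) :
    ∫⁻ x, F x = ∫⁻ θ in Ioo (-π) π, ∫⁻ r in Ioi 0, ENNReal.ofReal r * F (r • unitVec θ) := by
  let e := Complex.orthonormalBasisOneI.repr
  rw [← e.measurePreserving.lintegral_comp_emb e.toHomeomorph.measurableEmbedding,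
    ← Complex.lintegral_comp_polarCoord_symm, polarCoord_target, Measure.volume_eq_prod,
    ← Measure.prod_restrict]
  have hsymm (p : ℝ × ℝ) : e (Complex.polarCoord.symm p) = p.1 • unitVec p.2 := by
    rw [Complex.polarCoord_symm_apply, unitVec, ← map_smul, Complex.real_smul]
  simp only [hsymm, smul_eq_mul]
  refine lintegral_prod_symm _ (Measurable.aemeasurable ?_)
  have : Continuous fun p : ℝ × ℝ => p.1 • unitVec p.2 :=
    continuous_fst.smul (continuous_unitVec.comp continuous_snd)
  exact (ENNReal.measurable_ofReal.comp measurable_fst).mul (hF.comp this.measurable)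

theorem setLIntegral_closedBall_eq_polar (R : ℝ) {F : E2 → ℝ≥0∞} (hF : Measurable F) :
    ∫⁻ x in Metric.closedBall 0 R, F x =
      ∫⁻ θ in Ioo (-π) π, ∫⁻ r in Ioc 0 R, ENNReal.ofReal r * F (r • unitVec θ) := by
  have hball : MeasurableSet (Metric.closedBall (0 : E2) R) := measurableSet_closedBall
  rw [← lintegral_indicator hball, lintegral_eq_lintegral_polar (hF.indicator hball)]
  refine lintegral_congr fun θ => ?_
  rw [← lintegral_indicator measurableSet_Ioi, ← lintegral_indicator measurableSet_Ioc]
  refine lintegral_congr fun r => ?_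
  by_cases h0 : 0 < r <;> by_cases h1 : r ≤ R <;>
    simp [indicator, norm_smul, norm_unitVec, h0, h1, abs_of_pos]

theorem setLIntegral_ray_le {R r₀ : ℝ} (hR : 0 < R) (hRr : R < r₀) {k : ℝ}
    (hk : k = -(Real.log (R / r₀))⁻¹ / R ^ 2) {u : E2 → ℝ} (hu : ContDiff ℝ 1 u)
    {e : E2} (he : ‖e‖ = 1) :
    ∫⁻ r in Ioc 0 R, ENNReal.ofReal r *
        ENNReal.ofReal (u (r • e) ^ 2 / (‖r • e‖ ^ 2 * Real.log (‖r • e‖ / r₀) ^ 2)) ≤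
      ENNReal.ofReal (6 * k + 4 + 2 * k * R ^ 2) * ∫⁻ r in Ioc 0 R, ENNReal.ofReal r *
        ENNReal.ofReal (‖fderiv ℝ u (r • e)‖ ^ 2 + u (r • e) ^ 2) := by
  have huc := hu.continuous
  have hduc := hu.continuous_fderiv one_ne_zero
  have h := integral_sq_mul_log_weight_le hR hRr hk (f := fun r => u (r • e))
    (f' := fun r => fderiv ℝ u (r • e) e) (g := fun r => ‖fderiv ℝ u (r • e)‖)
    (fun r => by
      have h1 : HasDerivAt (fun r : ℝ => r • e) e r := by
        simpa using! (hasDerivAt_id r).smul_const e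
      exact ((hu.differentiable one_ne_zero) (r • e)).hasFDerivAt.comp_hasDerivAt r h1)
    (by fun_prop)
    (fun r => by simpa [he] using (fderiv ℝ u (r • e)).le_opNorm e)
  rw [intervalIntegral.integral_of_le hR.le, intervalIntegral.integral_of_le hR.le] at h
  have hLi : IntegrableOn (fun r => u (r • e) ^ 2 * (1 / (r * Real.log (r / r₀) ^ 2)))
      (Ioc 0 R) := by
    have := (intervalIntegrable_iff_integrableOn_Ioc_of_le hR.le).2
      (integrableOn_inv_mul_log_sq hR hRr)
    exact (intervalIntegrable_iff_integrableOn_Ioc_of_le hR.le).1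
      (this.continuousOn_mul (by fun_prop))
  have hRi : IntegrableOn (fun r => r * (‖fderiv ℝ u (r • e)‖ ^ 2 + u (r • e) ^ 2))
      (Ioc 0 R) :=
    (Continuous.integrableOn_Icc (by fun_prop)).mono_set Ioc_subset_Icc_self
  have hmem : ∀ᵐ r ∂volume.restrict (Ioc 0 R), r ∈ Ioc 0 R := ae_restrict_mem measurableSet_Ioc
  calc
    _ = ∫⁻ r in Ioc 0 R,
        ENNReal.ofReal (u (r • e) ^ 2 * (1 / (r * Real.log (r / r₀) ^ 2))) := by
      refine setLIntegral_congr_fun measurableSet_Ioc fun r hr => ?_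
      have hr0 := hr.1
      simp only [norm_smul, he, mul_one, Real.norm_eq_abs, abs_of_pos hr0]
      rw [← ENNReal.ofReal_mul hr0.le]
      congr 1
      by_cases hl : Real.log (r / r₀) = 0
      · simp [hl]
      · field_simp
    _ = ENNReal.ofReal (∫ r in Ioc 0 R, u (r • e) ^ 2 * (1 / (r * Real.log (r / r₀) ^ 2))) :=
      (ofReal_integral_eq_lintegral_ofReal hLi (by
        filter_upwards [hmem] with r hr
        have hr0 := hr.1
        simp only [Pi.zero_apply]
        positivity)).symm
    _ ≤ ENNReal.ofReal ((6 * k + 4 + 2 * k * R ^ 2) *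
        ∫ r in Ioc 0 R, r * (‖fderiv ℝ u (r • e)‖ ^ 2 + u (r • e) ^ 2)) :=
      ENNReal.ofReal_le_ofReal h
    _ = ENNReal.ofReal (6 * k + 4 + 2 * k * R ^ 2) * ∫⁻ r in Ioc 0 R,
        ENNReal.ofReal (r * (‖fderiv ℝ u (r • e)‖ ^ 2 + u (r • e) ^ 2)) := by
      rw [ENNReal.ofReal_mul' (setIntegral_nonneg measurableSet_Ioc fun r hr => by
          have hr0 := hr.1
          positivity),
        ofReal_integral_eq_lintegral_ofReal hRi (by
          filter_upwards [hmem] with r hr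
          have hr0 := hr.1
          simp only [Pi.zero_apply]
          positivity)]
    _ = _ := by
      congr 1
      exact setLIntegral_congr_fun measurableSet_Ioc fun r hr => ENNReal.ofReal_mul hr.1.le

/-- **Local Hardy inequality with singular logarithmic weight (Lemma on `L²_w`).**
For `0 < R < r₀` there is `C > 0` (depending only on `R, r₀`) such that for every
`u ∈ C¹(ℝ²; ℝ)`,
`∫_{|x|≤R} u²/(|x|²(log(|x|/r₀))²) ≤ C (∫_{|x|≤R} |∇u|² + ∫_{|x|≤R} u²)`. -/
theorem weighted_L2_bound (R r₀ : ℝ) (hR : 0 < R) (hRr : R < r₀) :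
    ∃ C : ℝ, 0 < C ∧ ∀ u : E2 → ℝ, ContDiff ℝ 1 u →
      ∫ x in Metric.closedBall (0 : E2) R,
          u x ^ 2 / (‖x‖ ^ 2 * Real.log (‖x‖ / r₀) ^ 2)
        ≤ C * ((∫ x in Metric.closedBall (0 : E2) R, ‖fderiv ℝ u x‖ ^ 2)
            + ∫ x in Metric.closedBall (0 : E2) R, u x ^ 2) := by
  have hRr₀ : Real.log (R / r₀) < 0 :=
    Real.log_neg (div_pos hR (hR.trans hRr)) ((div_lt_one (hR.trans hRr)).2 hRr)
  obtain ⟨k, hk⟩ : ∃ k, k = -(Real.log (R / r₀))⁻¹ / R ^ 2 := ⟨_, rfl⟩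
  have hk0 : 0 < k := by
    rw [hk]
    exact div_pos (neg_pos.2 (inv_neg''.2 hRr₀)) (by positivity)
  have hC : 0 < 6 * k + 4 + 2 * k * R ^ 2 := by positivity
  refine ⟨_, hC, fun u hu => ?_⟩
  have huc := hu.continuous
  have hduc := hu.continuous_fderiv one_ne_zero
  have hcpt : IsCompact (Metric.closedBall (0 : E2) R) := isCompact_closedBall _ _
  have hgi : IntegrableOn (fun x => ‖fderiv ℝ u x‖ ^ 2) (Metric.closedBall 0 R) :=
    (by fun_prop : Continuous fun x => ‖fderiv ℝ u x‖ ^ 2).continuousOn.integrableOn_compact hcpt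
  have hui : IntegrableOn (fun x => u x ^ 2) (Metric.closedBall 0 R) :=
    (by fun_prop : Continuous fun x => u x ^ 2).continuousOn.integrableOn_compact hcpt
  have hFm : Measurable fun x : E2 => u x ^ 2 / (‖x‖ ^ 2 * Real.log (‖x‖ / r₀) ^ 2) := by
    have := huc.measurable
    fun_prop
  have hGm : Measurable fun x : E2 => ‖fderiv ℝ u x‖ ^ 2 + u x ^ 2 :=
    (by fun_prop : Continuous fun x => ‖fderiv ℝ u x‖ ^ 2 + u x ^ 2).measurable
  rw [← integral_add hgi hui,
    integral_eq_lintegral_of_nonneg_ae (ae_of_all _ fun x => by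
      simp only [Pi.zero_apply]; positivity) hFm.aestronglyMeasurable]
  refine ENNReal.toReal_le_of_le_ofReal
    (mul_nonneg hC.le (integral_nonneg fun x => by positivity)) ?_
  rw [ENNReal.ofReal_mul hC.le,
    ofReal_integral_eq_lintegral_ofReal (hgi.fun_add hui) (ae_of_all _ fun x => by
      simp only [Pi.zero_apply]; positivity),
    setLIntegral_closedBall_eq_polar R hFm.ennreal_ofReal,
    setLIntegral_closedBall_eq_polar R hGm.ennreal_ofReal,
    ← lintegral_const_mul' _ _ ENNReal.ofReal_ne_top]
  exact lintegral_mono fun θ => setLIntegral_ray_le hR hRr hk hu (norm_unitVec θ)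

end
end

section
/- Let 0 < R < r₀ and let u ∈ C¹(ℝ²; ℝ). Then (1/4) ∫_{|x|<R} u(x)² / (|x|² (log(|x|/r₀))²) dx ≤ ∫_{|x|<R} |∇u(x)|² dx + (1/(2R log(r₀/R))) ∫_{|x|=R} u² dσ, where dσ is the one-dimensional (arclength) measure on the circle {|x| = R}. -/
open MeasureTheory Real Filter Set
open scoped ENNReal Topology

noncomputable section

/-- The reciprocal of the logarithm extends continuously by `0` to the origin. -/
theorem continuousAt_inv_log_zero : ContinuousAt (fun x : ℝ => (Real.log x)⁻¹) 0 := by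
  rw [continuousAt_iff_punctured_nhds]
  simpa using! Real.tendsto_log_nhdsNE_zero.inv_tendsto_atBot

/-- One-dimensional radial Hardy inequality with boundary term. -/
theorem integral_radial_hardy_le {R r₀ : ℝ} (hR : 0 < R) (hRr : R < r₀) {w w' D : ℝ → ℝ}
    (hw : ∀ r, HasDerivAt w (w' r) r) (hD : ∀ r, w' r ^ 2 ≤ D r) :
    ∫ r in Ioo 0 R, r * (1 / 4 * (w r ^ 2 / (r ^ 2 * Real.log (r / r₀) ^ 2)) - D r)
      ≤ w R ^ 2 / (2 * Real.log (r₀ / R)) := by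
  have hr₀ : 0 < r₀ := hR.trans hRr
  have hlogR : 0 < Real.log (r₀ / R) := Real.log_pos ((one_lt_div hR).2 hRr)
  set φ : ℝ → ℝ := fun r => r * (1 / 4 * (w r ^ 2 / (r ^ 2 * Real.log (r / r₀) ^ 2)) - D r)
  by_cases hφ : IntegrableOn φ (Ioo 0 R)
  swap
  · rw [integral_undef hφ]
    positivity
  have hlog : ∀ r, 0 < r → r ≤ R → Real.log (r / r₀) < 0 := fun r h0 h1 =>
    Real.log_neg (by positivity) ((div_lt_one hr₀).2 (h1.trans_lt hRr))
  let g : ℝ → ℝ := fun r => -(w r ^ 2 / 2) * (Real.log (r / r₀))⁻¹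
  let g' : ℝ → ℝ := fun r => -(w r * w' r) * (Real.log (r / r₀))⁻¹
    + w r ^ 2 / 2 * (r⁻¹ / Real.log (r / r₀) ^ 2)
  have hwc : Continuous w := continuous_iff_continuousAt.2 fun r => (hw r).continuousAt
  have hderiv : ∀ r, 0 < r → r ≤ R → HasDerivAt g (g' r) r := by
    intro r h0 h1
    have hl : HasDerivAt (fun r => Real.log (r / r₀)) r⁻¹ r := by
      convert ((hasDerivAt_id' r).div_const r₀).log (by simp [h0.ne', hr₀.ne']) using 1
      field_simp
    refine (((((hw r).pow 2).div_const 2).neg).mul (hl.inv (hlog r h0 h1).ne)).congr_deriv ?_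
    simp [g']
    ring
  have hcont : ContinuousOn g (Icc 0 R) := by
    intro r hr
    apply ContinuousAt.continuousWithinAt
    rcases hr.1.eq_or_lt with h0 | h0
    · subst h0
      refine (by fun_prop : ContinuousAt (fun r => -(w r ^ 2 / 2)) 0).mul ?_
      have h := continuousAt_inv_log_zero
      rw [← zero_div r₀] at h
      exact h.comp (f := fun r => r / r₀) (by fun_prop)
    · exact (hderiv r h0 hr.2).continuousAt
  have hle : ∀ r ∈ Ioo 0 R, φ r ≤ g' r := by
    rintro r ⟨h0, h1⟩
    have hl := (hlog r h0 h1.le).ne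
    have hsq : 0 ≤ r * (w' r - w r / (2 * r * Real.log (r / r₀))) ^ 2 := by positivity
    have hDr := mul_le_mul_of_nonneg_left (hD r) h0.le
    have key : g' r - r * (1 / 4 * (w r ^ 2 / (r ^ 2 * Real.log (r / r₀) ^ 2)) - w' r ^ 2)
        = r * (w' r - w r / (2 * r * Real.log (r / r₀))) ^ 2 := by
      simp only [g']
      field_simp
      ring
    simp only [φ]
    linarith
  have := intervalIntegral.integral_le_sub_of_hasDeriv_right_of_le hR.le hcont
    (fun r hr => (hderiv r hr.1 hr.2.le).hasDerivWithinAt)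
    (by rwa [integrableOn_Icc_iff_integrableOn_Ioo]) hle
  rw [intervalIntegral.integral_of_le hR.le, integral_Ioc_eq_integral_Ioo] at this
  refine this.trans_eq ?_
  have : Real.log (R / r₀) = -Real.log (r₀ / R) := by rw [← Real.log_inv, inv_div]
  simp only [g, zero_div, Real.log_zero, inv_zero, mul_zero, sub_zero, this]
  field_simp

theorem measurePreserving_mk2 : MeasurePreserving (fun p : ℝ × ℝ => mk2 p.1 p.2) :=
  (PiLp.volume_preserving_toLp (Fin 2)).comp (volume_preserving_finTwoArrow ℝ).symm

theorem measurableEmbedding_mk2 : MeasurableEmbedding (fun p : ℝ × ℝ => mk2 p.1 p.2) :=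
  (MeasurableEquiv.finTwoArrow.symm.trans
    (MeasurableEquiv.toLp 2 (Fin 2 → ℝ))).measurableEmbedding

/-- Integration in polar coordinates on the plane. -/
theorem integral_eq_integral_polar (f : E2 → ℝ) :
    ∫ x, f x = ∫ p in Ioi (0 : ℝ) ×ˢ Ioo (-π) π,
      p.1 * f (mk2 (p.1 * Real.cos p.2) (p.1 * Real.sin p.2)) := by
  rw [← measurePreserving_mk2.integral_comp measurableEmbedding_mk2,
    ← integral_comp_polarCoord_symm]
  rfl

/-- A bound for the radial integrals integrates to a bound for the planar integral. -/
theorem integral_le_of_radial_le {f : E2 → ℝ} {b : ℝ → ℝ}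
    (hb : IntegrableOn b (Ioo (-π) π)) (hb0 : ∀ θ, 0 ≤ b θ)
    (hle : ∀ θ, ∫ r in Ioi (0 : ℝ), r * f (mk2 (r * Real.cos θ) (r * Real.sin θ)) ≤ b θ) :
    ∫ x, f x ≤ ∫ θ in Ioo (-π) π, b θ := by
  rw [integral_eq_integral_polar]
  set F : ℝ × ℝ → ℝ := fun p => p.1 * f (mk2 (p.1 * Real.cos p.2) (p.1 * Real.sin p.2))
  by_cases hF : IntegrableOn F (Ioi (0 : ℝ) ×ˢ Ioo (-π) π)
  · rw [IntegrableOn, Measure.volume_eq_prod, ← Measure.prod_restrict] at hF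
    rw [Measure.volume_eq_prod, ← Measure.prod_restrict, integral_prod_symm _ hF]
    exact integral_mono hF.integral_prod_right hb hle
  · rw [integral_undef hF]
    exact integral_nonneg hb0

theorem mk2_mul_eq_smul (r a b : ℝ) : mk2 (r * a) (r * b) = r • mk2 a b := by
  ext i
  fin_cases i <;> simp [mk2]

theorem norm_mk2_cos_sin (θ : ℝ) : ‖mk2 (Real.cos θ) (Real.sin θ)‖ = 1 := by
  simp [EuclideanSpace.norm_eq, mk2]

/-- **Sharp local Hardy inequality with boundary term.**
For `0 < R < r₀` and `u ∈ C¹(ℝ²; ℝ)`: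
`(1/4)∫_{|x|<R} u²/(|x|²(log(|x|/r₀))²) ≤ ∫_{|x|<R} |∇u|² + (1/(2R log(r₀/R))) ∫_{|x|=R} u² dσ`,
the boundary circle being parametrized by arclength (`dσ = R dθ`). -/
theorem sharp_local_hardy_with_boundary (R r₀ : ℝ) (hR : 0 < R) (hRr : R < r₀)
    (u : E2 → ℝ) (hu : ContDiff ℝ 1 u) :
    (1 / 4) * ∫ x in Metric.ball (0 : E2) R,
        u x ^ 2 / (‖x‖ ^ 2 * Real.log (‖x‖ / r₀) ^ 2)
      ≤ (∫ x in Metric.ball (0 : E2) R, ‖fderiv ℝ u x‖ ^ 2)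
        + (1 / (2 * R * Real.log (r₀ / R))) *
            ∫ θ in (0:ℝ)..(2 * π), u (mk2 (R * Real.cos θ) (R * Real.sin θ)) ^ 2 * R := by
  have hlogR : 0 < Real.log (r₀ / R) := Real.log_pos ((one_lt_div hR).2 hRr)
  set A : E2 → ℝ := fun x => u x ^ 2 / (‖x‖ ^ 2 * Real.log (‖x‖ / r₀) ^ 2)
  set B : E2 → ℝ := fun x => ‖fderiv ℝ u x‖ ^ 2
  let c : ℝ → ℝ := fun θ => u (mk2 (R * Real.cos θ) (R * Real.sin θ)) ^ 2
  have hc : Continuous c := by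
    have : Continuous fun θ => mk2 (R * Real.cos θ) (R * Real.sin θ) := by
      simp only [mk2_mul_eq_smul]
      refine Continuous.const_smul ?_ R
      refine (PiLp.continuous_toLp 2 _).comp (continuous_pi fun i => ?_)
      fin_cases i <;> simp <;> fun_prop
    exact (hu.continuous.comp this).pow 2
  have hboundary : (1 / (2 * R * Real.log (r₀ / R))) * ∫ θ in (0:ℝ)..(2 * π), c θ * R
      = ∫ θ in Ioo (-π) π, c θ / (2 * Real.log (r₀ / R)) := by
    have hper : Function.Periodic c (2 * π) := fun θ => by simp [c]
    have hshift := hper.intervalIntegral_add_eq 0 (-π)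
    rw [zero_add, show -π + 2 * π = π by ring] at hshift
    rw [intervalIntegral.integral_mul_const, hshift,
      intervalIntegral.integral_of_le (by linarith [pi_pos]), integral_Ioc_eq_integral_Ioo,
      integral_div]
    field_simp
  have hB : IntegrableOn B (Metric.ball 0 R) :=
    ((((hu.continuous_fderiv one_ne_zero).norm.pow 2).continuousOn).integrableOn_compact
      (isCompact_closedBall 0 R)).mono_set Metric.ball_subset_closedBall
  rw [hboundary]
  have hint0 : 0 ≤ ∫ θ in Ioo (-π) π, c θ / (2 * Real.log (r₀ / R)) :=
    integral_nonneg fun θ => by positivity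
  by_cases hA : IntegrableOn A (Metric.ball 0 R)
  swap
  · rw [integral_undef hA, mul_zero]
    exact add_nonneg (integral_nonneg fun x => by positivity) hint0
  suffices h : ∫ x in Metric.ball (0 : E2) R, (1 / 4 * A x - B x)
      ≤ ∫ θ in Ioo (-π) π, c θ / (2 * Real.log (r₀ / R)) by
    rw [integral_sub (hA.const_mul _) hB, integral_const_mul] at h
    linarith
  rw [← integral_indicator Metric.isOpen_ball.measurableSet]
  refine integral_le_of_radial_le ?_ (fun θ => by positivity) fun θ => ?_
  · exact ((hc.div_const _).integrableOn_Icc).mono_set Ioo_subset_Icc_self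
  set e := mk2 (Real.cos θ) (Real.sin θ) with he
  have hnorm : ‖e‖ = 1 := norm_mk2_cos_sin θ
  have hw : ∀ r : ℝ, HasDerivAt (fun r : ℝ => u (r • e)) (fderiv ℝ u (r • e) e) r := fun r =>
    ((hu.differentiable one_ne_zero).differentiableAt.hasFDerivAt).comp_hasDerivAt r
      (by simpa using (hasDerivAt_id r).smul_const e)
  have hD : ∀ r : ℝ, fderiv ℝ u (r • e) e ^ 2 ≤ B (r • e) := fun r => by
    rw [← sq_abs, ← Real.norm_eq_abs]
    have := (fderiv ℝ u (r • e)).le_opNorm e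
    rw [hnorm, mul_one] at this
    exact pow_le_pow_left₀ (norm_nonneg _) this 2
  convert integral_radial_hardy_le hR hRr hw hD using 1
  · simp only [mk2_mul_eq_smul, ← he]
    rw [← Ioi_inter_Iio, ← setIntegral_indicator measurableSet_Iio]
    refine setIntegral_congr_fun measurableSet_Ioi fun r hr => ?_
    have hnr : ‖r • e‖ = r := by rw [norm_smul, hnorm, mul_one, Real.norm_of_nonneg (le_of_lt hr)]
    by_cases h : r < R <;> simp [indicator, h, hnr, A]
  · simp only [c, mk2_mul_eq_smul, ← he]

end
end

section
/- Let g : (0, ∞) → ℝ be a C¹ function with compact support contained in [2, ∞) and with g(2) = 0. Then ∫_2^∞ g'(r)² r dr ≥ (1/4) ∫_2^∞ g(r)² / (r (log r)²) dr. -/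
open MeasureTheory Real Filter Set
open scoped ENNReal Topology

noncomputable section

/-- A function continuous on `[a, ∞)` with compact support is integrable on `(a, ∞)`. -/
lemma integrableOn_Ioi_of_continuousOn_of_eq_zero {f : ℝ → ℝ} {a R : ℝ}
    (hf : ContinuousOn f (Set.Ici a)) (h0 : ∀ x, R < x → f x = 0) :
    IntegrableOn f (Set.Ioi a) := by
  have h : IntegrableOn f (Set.Icc a R) :=
    (hf.mono Set.Icc_subset_Ici_self).integrableOn_Icc
  refine h.of_forall_sdiff_eq_zero measurableSet_Ioi fun x hx => h0 x ?_
  by_contra! hxR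
  exact hx.2 ⟨le_of_lt hx.1, hxR⟩

/-- The derivative of `g² / (2 log r)`, for `r > 1`. -/
lemma hasDerivAt_sq_div_two_mul_log {g : ℝ → ℝ} {r : ℝ} (hg : DifferentiableAt ℝ g r)
    (hr : 1 < r) :
    HasDerivAt (fun r => g r ^ 2 / (2 * Real.log r))
      (g r * deriv g r / Real.log r - g r ^ 2 / (2 * (r * Real.log r ^ 2))) r := by
  have hlog : Real.log r ≠ 0 := (Real.log_pos hr).ne'
  have hr0 : r ≠ 0 := by positivity
  have h := (hg.hasDerivAt.pow 2).div ((Real.hasDerivAt_log hr0).const_mul 2)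
    (mul_ne_zero two_ne_zero hlog)
  refine h.congr_deriv ?_
  simp only [Pi.pow_apply]
  field_simp
  push_cast
  ring

/-- **One-dimensional weighted Hardy inequality with logarithmic weight.**
If `g` is `C¹` with compact support contained in `[2, ∞)` and `g(2) = 0`, then
`∫_2^∞ g'(r)² r dr ≥ (1/4) ∫_2^∞ g(r)²/(r (log r)²) dr`. -/
theorem one_dim_log_hardy (g : ℝ → ℝ) (hg : ContDiff ℝ 1 g)
    (hsupp : HasCompactSupport g) (hIci : tsupport g ⊆ Set.Ici 2) (hg2 : g 2 = 0) :
    ∫ r in Set.Ioi (2:ℝ), deriv g r ^ 2 * r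
      ≥ (1 / 4) * ∫ r in Set.Ioi (2:ℝ), g r ^ 2 / (r * Real.log r ^ 2) := by
  obtain ⟨R, hR⟩ := hsupp.isCompact.bddAbove
  have hg0 : ∀ x, R < x → g x = 0 := fun x hx =>
    image_eq_zero_of_notMem_tsupport fun h => (hR h).not_gt hx
  have hdg0 : ∀ x, R < x → deriv g x = 0 := fun x hx =>
    image_eq_zero_of_notMem_tsupport fun h => (hR (tsupport_deriv_subset h)).not_gt hx
  have hgc : Continuous g := hg.continuous
  have hdgc : Continuous (deriv g) := hg.continuous_deriv le_rfl
  have hlogc : ContinuousOn Real.log (Set.Ici (2 : ℝ)) :=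
    Real.continuousOn_log.mono fun x hx => by
      have : (2 : ℝ) ≤ x := hx
      exact (by positivity : x ≠ 0)
  have hlog : ∀ x ∈ Set.Ici (2 : ℝ), Real.log x ≠ 0 := fun x hx =>
    (Real.log_pos (lt_of_lt_of_le one_lt_two hx)).ne'
  have hpos : ∀ x ∈ Set.Ici (2 : ℝ), x ≠ 0 := fun x hx =>
    (lt_of_lt_of_le two_pos hx).ne'
  have hweight : ∀ x ∈ Set.Ici (2 : ℝ), x * Real.log x ^ 2 ≠ 0 := fun x hx =>
    mul_ne_zero (hpos x hx) (pow_ne_zero 2 (hlog x hx))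
  have hwc : ContinuousOn (fun x => x * Real.log x ^ 2) (Set.Ici (2 : ℝ)) :=
    continuousOn_id.mul (hlogc.pow 2)
  have hA : IntegrableOn (fun r => deriv g r ^ 2 * r) (Set.Ioi 2) :=
    integrableOn_Ioi_of_continuousOn_of_eq_zero (R := R) (by fun_prop)
      fun x hx => by simp [hdg0 x hx]
  have hB : IntegrableOn (fun r => g r ^ 2 / (r * Real.log r ^ 2)) (Set.Ioi 2) :=
    integrableOn_Ioi_of_continuousOn_of_eq_zero (R := R)
      ((hgc.pow 2).continuousOn.div hwc hweight) fun x hx => by simp [hg0 x hx]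
  have hF : IntegrableOn
      (fun r => g r * deriv g r / Real.log r - g r ^ 2 / (2 * (r * Real.log r ^ 2)))
      (Set.Ioi 2) :=
    integrableOn_Ioi_of_continuousOn_of_eq_zero (R := R)
      (((hgc.mul hdgc).continuousOn.div hlogc hlog).sub
        ((hgc.pow 2).continuousOn.div (continuousOn_const.mul hwc)
          fun x hx => mul_ne_zero two_ne_zero (hweight x hx)))
      fun x hx => by simp [hg0 x hx]
  have hderiv : ∀ x ∈ Set.Ici (2 : ℝ), HasDerivAt (fun r => g r ^ 2 / (2 * Real.log r))
      (g x * deriv g x / Real.log x - g x ^ 2 / (2 * (x * Real.log x ^ 2))) x := fun x hx =>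
    hasDerivAt_sq_div_two_mul_log (hg.differentiable one_ne_zero x)
      (lt_of_lt_of_le one_lt_two hx)
  have hlim : Tendsto (fun r => g r ^ 2 / (2 * Real.log r)) atTop (𝓝 0) :=
    tendsto_const_nhds.congr' <| (eventually_gt_atTop R).mono fun x hx => by simp [hg0 x hx]
  have hFTC := integral_Ioi_of_hasDerivAt_of_tendsto' hderiv hF hlim
  simp only [hg2, ne_eq, OfNat.ofNat_ne_zero, not_false_eq_true, zero_pow, zero_div,
    sub_zero] at hFTC
  have hmono := setIntegral_mono_on hF (hA.sub (hB.const_mul (1 / 4))) measurableSet_Ioi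
    fun x hx => by
      have hx2 : (2 : ℝ) < x := hx
      have hl := hlog x hx2.le
      have hx0 := hpos x hx2.le
      have hsq : 0 ≤ (deriv g x - g x / (2 * x * Real.log x)) ^ 2 * x := by positivity
      have hid : (deriv g x - g x / (2 * x * Real.log x)) ^ 2 * x
          = (deriv g x ^ 2 * x - 1 / 4 * (g x ^ 2 / (x * Real.log x ^ 2)))
            - (g x * deriv g x / Real.log x - g x ^ 2 / (2 * (x * Real.log x ^ 2))) := by
        field_simp
        ring
      exact sub_nonneg.mp (hid ▸ hsq)
  have hsub := integral_sub hA (hB.const_mul (1 / 4))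
  rw [integral_const_mul] at hsub
  simp only [Pi.sub_apply] at hmono
  linarith

end
end

section
/- For every c > 0 there exists a constant C > 0 such that for all f ∈ C_c^∞((0, ∞); ℝ): ∫_0^∞ f'(r)² r dr + c ∫_0^e f(r)² r dr ≥ C ∫_e^∞ f(r)² / (r (log r)²) dr. -/
open MeasureTheory Real Filter Set
open scoped ENNReal Topology

noncomputable section

/-- On `(0, e]` the energy controls the boundary value `f(e)²`. -/
theorem mul_sq_exp_one_le_integral {a c : ℝ} (ha : 0 ≤ a) (hac : 2 * a + a ^ 2 ≤ c * exp 1 ^ 2)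
    {f : ℝ → ℝ} (hf : ContDiff ℝ 1 f) :
    a * f (exp 1) ^ 2 ≤
      ∫ r in (0 : ℝ)..exp 1, (deriv f r ^ 2 * r + c * (f r ^ 2 * r)) := by
  have hd : Continuous (deriv f) := hf.continuous_deriv le_rfl
  have hcf : Continuous f := hf.continuous
  have hderiv : ∀ r, HasDerivAt f (deriv f r) r := fun r =>
    (hf.differentiable one_ne_zero r).hasDerivAt
  have he : 0 < exp 1 := exp_pos 1
  have hprim : ∀ r, HasDerivAt (fun r => f r ^ 2 * (a * r ^ 2 / exp 1 ^ 2))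
      (2 * f r * deriv f r * (a * r ^ 2 / exp 1 ^ 2) + f r ^ 2 * (a * (2 * r) / exp 1 ^ 2)) r := by
    intro r
    have h := ((hderiv r).pow 2).mul
      ((((hasDerivAt_id r).pow 2).const_mul a).div_const (exp 1 ^ 2))
    refine h.congr_deriv ?_
    simp
  have hint := intervalIntegral.integral_eq_sub_of_hasDerivAt (a := 0) (b := exp 1)
    (fun r _ => hprim r) (Continuous.intervalIntegrable (by fun_prop) _ _)
  have hval : a * f (exp 1) ^ 2 = f (exp 1) ^ 2 * (a * exp 1 ^ 2 / exp 1 ^ 2)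
      - f 0 ^ 2 * (a * 0 ^ 2 / exp 1 ^ 2) := by
    field_simp
    ring
  rw [hval, ← hint]
  refine intervalIntegral.integral_mono_on he.le (Continuous.intervalIntegrable (by fun_prop) _ _)
    (Continuous.intervalIntegrable (by fun_prop) _ _) fun r hr => ?_
  have hr0 : 0 ≤ r := hr.1
  set k : ℝ := a / exp 1 ^ 2 with hk
  have hc : 2 * k + k ^ 2 * exp 1 ^ 2 ≤ c := by
    have : 2 * k + k ^ 2 * exp 1 ^ 2 = (2 * a + a ^ 2) / exp 1 ^ 2 := by
      rw [hk]; field_simp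
    rw [this, div_le_iff₀ (by positivity)]
    exact hac
  have hkr : k ^ 2 * r ^ 2 ≤ k ^ 2 * exp 1 ^ 2 := by
    have := hr.2
    gcongr
  have hle : (2 * k + k ^ 2 * r ^ 2) * (f r ^ 2 * r) ≤ c * (f r ^ 2 * r) :=
    mul_le_mul_of_nonneg_right (by linarith) (by positivity)
  have hsq : 0 ≤ (deriv f r - k * r * f r) ^ 2 * r := by positivity
  have e1 : a * r ^ 2 / exp 1 ^ 2 = k * r ^ 2 := by rw [hk]; ring
  have e2 : a * (2 * r) / exp 1 ^ 2 = k * (2 * r) := by rw [hk]; ring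
  rw [e1, e2]
  linarith

/-- The logarithmic Hardy inequality on `[e, R]`, with a boundary term at `e`. -/
theorem integral_log_hardy_le {a R : ℝ} (hR : exp 1 ≤ R) {f : ℝ → ℝ} (hf : ContDiff ℝ 1 f)
    (hfR : f R = 0) :
    (a - a ^ 2) * ∫ r in exp 1..R, f r ^ 2 / (r * log r ^ 2) ≤
      (∫ r in exp 1..R, deriv f r ^ 2 * r) + a * f (exp 1) ^ 2 := by
  have hd : Continuous (deriv f) := hf.continuous_deriv le_rfl
  have hcf : Continuous f := hf.continuous
  have hderiv : ∀ r, HasDerivAt f (deriv f r) r := fun r =>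
    (hf.differentiable one_ne_zero r).hasDerivAt
  have hpos : ∀ r ∈ uIcc (exp 1) R, 0 < r := fun r hr =>
    (exp_pos 1).trans_le (uIcc_of_le hR ▸ hr).1
  have hlog : ∀ r ∈ uIcc (exp 1) R, 0 < log r := fun r hr =>
    one_pos.trans_le ((le_log_iff_exp_le (hpos r hr)).2 (uIcc_of_le hR ▸ hr).1)
  have hclog : ContinuousOn log (uIcc (exp 1) R) :=
    continuousOn_log.mono fun r hr => (hpos r hr).ne'
  have hprim : ∀ r ∈ uIcc (exp 1) R, HasDerivAt (fun r => f r ^ 2 * (a / log r))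
      (2 * f r * deriv f r * (a / log r) - a * (f r ^ 2 / (r * log r ^ 2))) r := by
    intro r hr
    have hl := (hlog r hr).ne'
    have hr0 := (hpos r hr).ne'
    have h := ((hderiv r).pow 2).mul (((hasDerivAt_log hr0).inv hl).const_mul a)
    refine h.congr_deriv ?_
    simp
    field_simp
    ring
  have hw : IntervalIntegrable (fun r => f r ^ 2 / (r * log r ^ 2)) volume (exp 1) R :=
    ContinuousOn.intervalIntegrable <| (hcf.pow 2).continuousOn.div
      (continuousOn_id.mul (hclog.pow 2)) fun r hr =>
        (mul_pos (hpos r hr) (pow_pos (hlog r hr) 2)).ne'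
  have hcross : IntervalIntegrable (fun r => 2 * f r * deriv f r * (a / log r)) volume
      (exp 1) R :=
    ContinuousOn.intervalIntegrable <| ((continuous_const.mul hcf).mul hd).continuousOn.mul
      (continuousOn_const.div hclog fun r hr => (hlog r hr).ne')
  have hE : IntervalIntegrable (fun r => deriv f r ^ 2 * r) volume (exp 1) R :=
    Continuous.intervalIntegrable (by fun_prop) _ _
  have hint := intervalIntegral.integral_eq_sub_of_hasDerivAt hprim (hcross.sub (hw.const_mul a))
  have hmono : ∫ r in exp 1..R, (a - a ^ 2) * (f r ^ 2 / (r * log r ^ 2)) ≤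
      ∫ r in exp 1..R, (deriv f r ^ 2 * r - (2 * f r * deriv f r * (a / log r)
        - a * (f r ^ 2 / (r * log r ^ 2)))) := by
    refine intervalIntegral.integral_mono_on hR (hw.const_mul _)
      (hE.sub (hcross.sub (hw.const_mul a))) fun r hr => ?_
    rw [← uIcc_of_le hR] at hr
    have hr0 := hpos r hr
    have hl := hlog r hr
    have hsq : 0 ≤ (deriv f r - a * f r / (r * log r)) ^ 2 * r := by positivity
    have heq : (deriv f r - a * f r / (r * log r)) ^ 2 * r = deriv f r ^ 2 * r
        - 2 * f r * deriv f r * (a / log r) + a ^ 2 * (f r ^ 2 / (r * log r ^ 2)) := by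
      field_simp
      ring
    linarith
  rw [intervalIntegral.integral_const_mul,
    intervalIntegral.integral_sub hE (hcross.sub (hw.const_mul a)), hint] at hmono
  simp only [hfR, log_exp] at hmono
  linarith

/-- **One-dimensional inequality used to extend the Hardy weight to infinity.**
For every `c > 0` there is `C > 0` such that for all `f ∈ C_c^∞((0,∞); ℝ)`:
`∫_0^∞ f'(r)² r dr + c ∫_0^e f(r)² r dr ≥ C ∫_e^∞ f(r)²/(r (log r)²) dr`. -/
theorem one_dim_extension_ineq (c : ℝ) (hc : 0 < c) :
    ∃ C : ℝ, 0 < C ∧ ∀ f : ℝ → ℝ, ContDiff ℝ (⊤ : ℕ∞) f → HasCompactSupport f →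
      tsupport f ⊆ Set.Ioi 0 →
      (∫ r in Set.Ioi (0:ℝ), deriv f r ^ 2 * r)
          + c * ∫ r in Set.Ioc (0:ℝ) (Real.exp 1), f r ^ 2 * r
        ≥ C * ∫ r in Set.Ioi (Real.exp 1), f r ^ 2 / (r * Real.log r ^ 2) := by
  set a : ℝ := min (1 / 2) c with ha
  have ha0 : 0 < a := lt_min (by norm_num) hc
  have ha2 : a ≤ 1 / 2 := min_le_left _ _
  have hac : a ≤ c := min_le_right _ _
  refine ⟨a - a ^ 2, by nlinarith, fun f hf hsupp _ => ?_⟩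
  have hf1 : ContDiff ℝ 1 f := hf.of_le (by exact_mod_cast le_top)
  have hd : Continuous (deriv f) := hf1.continuous_deriv le_rfl
  have hcf : Continuous f := hf1.continuous
  obtain ⟨R₀, hR₀⟩ := hsupp.isCompact.bddAbove
  set R : ℝ := max (R₀ + 1) (exp 1)
  have hR : exp 1 ≤ R := le_max_right _ _
  have hout : ∀ r, R ≤ r → r ∉ tsupport f := fun r hr hmem => by
    have h1 := hR₀ hmem
    have h2 : R₀ + 1 ≤ R := le_max_left _ _
    linarith
  have hf0 : ∀ r, R ≤ r → f r = 0 := fun r hr => image_eq_zero_of_notMem_tsupport (hout r hr)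
  have hd0 : ∀ r, R ≤ r → deriv f r = 0 := fun r hr =>
    Function.notMem_support.1 fun h => hout r hr (support_deriv_subset h)
  have he : 0 < exp 1 := exp_pos 1
  have hE : ∫ r in Set.Ioi (0:ℝ), deriv f r ^ 2 * r = ∫ r in (0:ℝ)..R, deriv f r ^ 2 * r := by
    rw [intervalIntegral.integral_of_le (he.le.trans hR)]
    refine setIntegral_eq_of_subset_of_forall_sdiff_eq_zero measurableSet_Ioi
      Ioc_subset_Ioi_self fun r hr => ?_
    rw [hd0 r (le_of_not_ge fun h => hr.2 ⟨hr.1, h⟩)]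
    simp
  have hW : ∫ r in Set.Ioi (exp 1), f r ^ 2 / (r * log r ^ 2) =
      ∫ r in exp 1..R, f r ^ 2 / (r * log r ^ 2) := by
    rw [intervalIntegral.integral_of_le hR]
    refine setIntegral_eq_of_subset_of_forall_sdiff_eq_zero measurableSet_Ioi
      Ioc_subset_Ioi_self fun r hr => ?_
    rw [hf0 r (le_of_not_ge fun h => hr.2 ⟨hr.1, h⟩)]
    simp
  have hcontE : Continuous fun r => deriv f r ^ 2 * r := by fun_prop
  have hcontF : Continuous fun r => f r ^ 2 * r := by fun_prop
  have haE : 2 * a + a ^ 2 ≤ c * exp 1 ^ 2 := by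
    have h4 : 4 ≤ exp 1 ^ 2 := by nlinarith [add_one_le_exp (1 : ℝ)]
    nlinarith [mul_le_mul_of_nonneg_left h4 hc.le]
  have hinner := mul_sq_exp_one_le_integral (a := a) (c := c) ha0.le
    haE hf1
  rw [intervalIntegral.integral_add (hcontE.intervalIntegrable _ _)
    ((hcontF.intervalIntegrable _ _).const_mul c), intervalIntegral.integral_const_mul] at hinner
  have houter := integral_log_hardy_le (a := a) hR hf1 (hf0 R le_rfl)
  rw [hE, hW, ← intervalIntegral.integral_of_le he.le,
    ← intervalIntegral.integral_add_adjacent_intervals (hcontE.intervalIntegrable 0 (exp 1))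
      (hcontE.intervalIntegrable (exp 1) R)]
  linarith

end
end

section
/- Let γ > 1 and b₀ ∈ ℝ, and define B_s : ℝ² → ℝ by B_s(x) = b₀ / ( |x|² |log|x||^γ ) for 0 < |x| ≤ e^{−1} and B_s(x) = 0 otherwise. Then B_s ∈ L¹(ℝ²), and for every 0 < r ≤ e^{−1}: ∫_{|x|<r} B_s(x) dx = ( 2π b₀ / (γ − 1) ) |log r|^{1−γ}. Moreover, if b₀ ≠ 0 then for every ε > 0 one has r^{−ε} | ∫_{|x|<r} B_s dx | → ∞ as r → 0⁺. -/
open MeasureTheory Real Filter Set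
open scoped ENNReal Topology

noncomputable section

/-- The singular field of Example 1: `B_s(x) = b₀/(|x|² |log|x||^γ)` for `0 < |x| ≤ e⁻¹`. -/
def BsOne (γ b₀ : ℝ) (x : E2) : ℝ :=
  if 0 < ‖x‖ ∧ ‖x‖ ≤ Real.exp (-1) then b₀ / (‖x‖ ^ 2 * |Real.log ‖x‖| ^ γ) else 0

/-- The function `y ↦ (-log y)^(1-γ) / (γ-1)` vanishes at `0` and is a primitive of
`y ↦ y⁻¹ (-log y)^(-γ)` on `(0, 1)`. -/
lemma hasDerivAt_neg_log_rpow {γ y : ℝ} (hγ : 1 < γ) (h0 : 0 < y) (h1 : y < 1) :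
    HasDerivAt (fun y : ℝ => (-Real.log y) ^ (1 - γ) / (γ - 1))
      (y⁻¹ * (-Real.log y) ^ (-γ)) y := by
  have hlog : 0 < -Real.log y := neg_pos.2 (Real.log_neg h0 h1)
  have h := (((Real.hasDerivAt_log h0.ne').neg).rpow_const (p := 1 - γ)
    (Or.inl hlog.ne')).div_const (γ - 1)
  refine h.congr_deriv ?_
  have : γ - 1 ≠ 0 := by linarith
  rw [Pi.neg_apply, show 1 - γ - 1 = -γ by ring]
  field_simp
  ring

lemma tendsto_neg_log_nhdsGT_zero : Tendsto (fun y : ℝ => -Real.log y) (𝓝[>] 0) atTop :=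
  tendsto_neg_atBot_atTop.comp Real.tendsto_log_nhdsGT_zero

lemma continuousOn_neg_log_rpow {γ r : ℝ} (hγ : 1 < γ) (h1 : r < 1) :
    ContinuousOn (fun y : ℝ => (-Real.log y) ^ (1 - γ) / (γ - 1)) (Icc 0 r) := by
  intro y hy
  rcases hy.1.eq_or_lt with rfl | h0
  · have h : Tendsto (fun y : ℝ => (-Real.log y) ^ (1 - γ) / (γ - 1)) (𝓝[>] 0) (𝓝 0) := by
      have := ((tendsto_rpow_neg_atTop (sub_pos.2 hγ)).comp
        tendsto_neg_log_nhdsGT_zero).div_const (γ - 1)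
      simpa [Function.comp_def] using this
    have hc : ContinuousWithinAt (fun y : ℝ => (-Real.log y) ^ (1 - γ) / (γ - 1)) (Ioi 0) 0 := by
      have e : (0 : ℝ) ^ (1 - γ) = 0 := Real.zero_rpow (by linarith)
      simpa [ContinuousWithinAt, e] using h
    exact (continuousWithinAt_Ioi_iff_Ici.1 hc).mono Icc_subset_Ici_self
  · exact (hasDerivAt_neg_log_rpow hγ h0
      (hy.2.trans_lt h1)).continuousAt.continuousWithinAt

lemma integrableOn_inv_mul_neg_log_rpow {γ r : ℝ} (hγ : 1 < γ) (h1 : r < 1) :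
    IntegrableOn (fun y : ℝ => y⁻¹ * (-Real.log y) ^ (-γ)) (Ioc 0 r) := by
  refine intervalIntegral.integrableOn_deriv_of_nonneg (continuousOn_neg_log_rpow hγ h1)
    (fun y hy => hasDerivAt_neg_log_rpow hγ hy.1 (hy.2.trans h1)) fun y hy => ?_
  have := Real.log_neg hy.1 (hy.2.trans h1)
  exact mul_nonneg (inv_nonneg.2 hy.1.le) (Real.rpow_nonneg (by linarith) _)

lemma setIntegral_inv_mul_neg_log_rpow {γ r : ℝ} (hγ : 1 < γ) (h0 : 0 < r) (h1 : r < 1) :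
    ∫ y in Ioc 0 r, y⁻¹ * (-Real.log y) ^ (-γ) = (-Real.log r) ^ (1 - γ) / (γ - 1) := by
  have e : (0 : ℝ) ^ (1 - γ) = 0 := Real.zero_rpow (by linarith)
  rw [← intervalIntegral.integral_of_le h0.le,
    intervalIntegral.integral_eq_sub_of_hasDerivAt_of_le h0.le
      (continuousOn_neg_log_rpow hγ h1)
      (fun y hy => hasDerivAt_neg_log_rpow hγ hy.1 (hy.2.trans h1))
      ((intervalIntegrable_iff_integrableOn_Ioc_of_le h0.le).2
        (integrableOn_inv_mul_neg_log_rpow hγ h1))]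
  simp [e]

/-- The radial profile of `BsOne`. -/
def BsOneProfile (γ b₀ y : ℝ) : ℝ :=
  if 0 < y ∧ y ≤ Real.exp (-1) then b₀ / (y ^ 2 * |Real.log y| ^ γ) else 0

lemma exp_neg_one_lt_one : Real.exp (-1) < 1 := by simp

lemma mul_BsOneProfile {γ b₀ y : ℝ} (h0 : 0 < y) (h : y ≤ Real.exp (-1)) :
    y * BsOneProfile γ b₀ y = b₀ * (y⁻¹ * (-Real.log y) ^ (-γ)) := by
  have hlog := Real.log_neg h0 (h.trans_lt exp_neg_one_lt_one)
  have hpos : 0 < (-Real.log y) ^ γ := Real.rpow_pos_of_pos (by linarith) _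
  rw [BsOneProfile, if_pos ⟨h0, h⟩, abs_of_neg hlog, Real.rpow_neg (by linarith)]
  field_simp

lemma integrable_BsOne {γ : ℝ} (hγ : 1 < γ) (b₀ : ℝ) : Integrable (BsOne γ b₀) volume := by
  refine (integrable_fun_norm_addHaar (E := E2) volume (f := BsOneProfile γ b₀)).2 ?_
  rw [finrank_euclideanSpace_fin]
  have hI : IntegrableOn (fun y : ℝ => y ^ (2 - 1) • BsOneProfile γ b₀ y)
      (Ioc 0 (Real.exp (-1))) := by
    refine IntegrableOn.congr_fun
      ((integrableOn_inv_mul_neg_log_rpow hγ exp_neg_one_lt_one).const_mul b₀)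
      (fun y hy => ?_) measurableSet_Ioc
    simpa using (mul_BsOneProfile hy.1 hy.2).symm
  refine hI.of_forall_sdiff_eq_zero measurableSet_Ioi fun y hy => ?_
  have : ¬ (0 < y ∧ y ≤ Real.exp (-1)) := hy.2
  simp [BsOneProfile, this]

lemma integral_ball_BsOne {γ r : ℝ} (hγ : 1 < γ) (b₀ : ℝ) (h0 : 0 < r)
    (hr : r ≤ Real.exp (-1)) :
    ∫ x in Metric.ball (0 : E2) r, BsOne γ b₀ x
      = (2 * π * b₀ / (γ - 1)) * |Real.log r| ^ (1 - γ) := by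
  have h1 := hr.trans_lt exp_neg_one_lt_one
  have hind : (Metric.ball (0 : E2) r).indicator (BsOne γ b₀)
      = fun x => (Iio r).indicator (BsOneProfile γ b₀) ‖x‖ := by
    ext x
    simp [indicator, BsOne, BsOneProfile]
  have hvol : volume.real (Metric.ball (0 : E2) 1) = π := by
    simp [Measure.real, EuclideanSpace.volume_ball_fin_two, Real.pi_pos.le]
  have hradial : ∫ y in Ioi (0 : ℝ), y ^ (2 - 1) • (Iio r).indicator (BsOneProfile γ b₀) y
      = b₀ * ((-Real.log r) ^ (1 - γ) / (γ - 1)) := by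
    rw [← setIntegral_inv_mul_neg_log_rpow hγ h0 h1, ← integral_const_mul,
      integral_Ioc_eq_integral_Ioo, ← Ioi_inter_Iio, ← setIntegral_indicator measurableSet_Iio]
    refine setIntegral_congr_fun measurableSet_Ioi fun y hy => ?_
    by_cases hyr : y < r
    · simpa [indicator, hyr] using mul_BsOneProfile hy (hyr.le.trans hr)
    · simp [indicator, hyr]
  rw [← integral_indicator measurableSet_ball, hind,
    integral_fun_norm_addHaar (E := E2) volume, finrank_euclideanSpace_fin, hradial, hvol,
    abs_of_neg (Real.log_neg h0 h1)]
  simp only [smul_eq_mul, nsmul_eq_mul, Nat.cast_ofNat]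
  ring

/-- **Example 1.** For `γ > 1` the field `B_s` is in `L¹(ℝ²)`, its flux through the ball
of radius `r ≤ e⁻¹` equals `(2π b₀/(γ−1)) |log r|^{1−γ}`, and if `b₀ ≠ 0` the flux decays
slower than any power of `r`. -/
theorem example_one (γ b₀ : ℝ) (hγ : 1 < γ) :
    Integrable (BsOne γ b₀) volume ∧
    (∀ r : ℝ, 0 < r → r ≤ Real.exp (-1) →
      ∫ x in Metric.ball (0 : E2) r, BsOne γ b₀ x
        = (2 * π * b₀ / (γ - 1)) * |Real.log r| ^ (1 - γ)) ∧
    (b₀ ≠ 0 → ∀ ε : ℝ, 0 < ε →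
      Filter.Tendsto
        (fun r : ℝ => r ^ (-ε) * |∫ x in Metric.ball (0 : E2) r, BsOne γ b₀ x|)
        (𝓝[>] (0:ℝ)) Filter.atTop) := by
  refine ⟨integrable_BsOne hγ b₀, fun r h0 hr => integral_ball_BsOne hγ b₀ h0 hr,
    fun hb ε hε => ?_⟩
  have hC : 0 < |2 * π * b₀ / (γ - 1)| :=
    abs_pos.2 (div_ne_zero (by simp [hb, Real.pi_ne_zero]) (sub_pos.2 hγ).ne')
  refine (((tendsto_exp_mul_div_rpow_atTop (γ - 1) ε hε).comp
    tendsto_neg_log_nhdsGT_zero).const_mul_atTop hC).congr' ?_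
  filter_upwards [Ioc_mem_nhdsGT (Real.exp_pos (-1))] with r hr
  have hlog := Real.log_neg hr.1 (hr.2.trans_lt exp_neg_one_lt_one)
  rw [integral_ball_BsOne hγ b₀ hr.1 hr.2, abs_mul, abs_of_neg hlog,
    abs_of_nonneg (Real.rpow_nonneg (neg_pos.2 hlog).le _), Function.comp_apply,
    Real.rpow_def_of_pos hr.1, ← neg_sub γ 1, Real.rpow_neg (neg_pos.2 hlog).le,
    show Real.log r * -ε = ε * -Real.log r by ring]
  ring

end
end

section
/- Let γ > 1 and b₀ ∈ ℝ, and define B_s : ℝ² → ℝ by B_s(x) = b₀ / ( |x|² |log|x|| (log|log|x||)^γ ) for 0 < |x| ≤ e^{−2} and B_s(x) = 0 otherwise. Then B_s ∈ L¹(ℝ²), and for every 0 < r ≤ e^{−2}: ∫_{|x|<r} B_s(x) dx = ( 2π b₀ / (γ − 1) ) ( log|log r| )^{1−γ}. -/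
open MeasureTheory Real Filter Set
open scoped ENNReal Topology

noncomputable section

/-- The singular field of Example 2:
`B_s(x) = b₀/(|x|² |log|x|| (log|log|x||)^γ)` for `0 < |x| ≤ e⁻²`. -/
def BsTwo (γ b₀ : ℝ) (x : E2) : ℝ :=
  if 0 < ‖x‖ ∧ ‖x‖ ≤ Real.exp (-2) then
    b₀ / (‖x‖ ^ 2 * |Real.log ‖x‖| * Real.log |Real.log ‖x‖| ^ γ)
  else 0

/-- The weight `1/(y |log y| (log|log y|)^γ)`: the radial density of `BsTwo γ 1` in polar
coordinates. -/
def iterLogDensity (γ y : ℝ) : ℝ :=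
  1 / (y * |Real.log y| * Real.log |Real.log y| ^ γ)

/-- The primitive `(log|log y|)^(1-γ)/(γ-1)` of `iterLogDensity γ`. -/
def iterLogPrimitive (γ y : ℝ) : ℝ :=
  Real.log |Real.log y| ^ (1 - γ) / (γ - 1)

lemma log_le_neg_two {y : ℝ} (hy : 0 < y) (hy' : y ≤ Real.exp (-2)) : Real.log y ≤ -2 :=
  (Real.log_le_iff_le_exp hy).2 hy'

lemma log_abs_log_pos {y : ℝ} (hy : 0 < y) (hy' : y ≤ Real.exp (-2)) :
    0 < Real.log |Real.log y| := by
  have h := log_le_neg_two hy hy'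
  apply Real.log_pos
  rw [abs_of_neg (by linarith)]
  linarith

lemma hasDerivAt_iterLogPrimitive {γ y : ℝ} (hγ : 1 < γ) (hy : 0 < y)
    (hy' : y ≤ Real.exp (-2)) :
    HasDerivAt (iterLogPrimitive γ) (iterLogDensity γ y) y := by
  have hlog := log_le_neg_two hy hy'
  have hpos := log_abs_log_pos hy hy'
  have h := ((((Real.hasDerivAt_log hy.ne').log (by linarith)).rpow_const (p := 1 - γ)
    (Or.inl (by rw [← Real.log_abs]; exact hpos.ne'))).div_const (γ - 1))
  have hfun : iterLogPrimitive γ =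
      fun z => Real.log (Real.log z) ^ (1 - γ) / (γ - 1) := by
    funext z
    rw [iterLogPrimitive, Real.log_abs]
  rw [hfun]
  refine h.congr_deriv ?_
  have hγ' : γ - 1 ≠ 0 := by linarith
  have hlog' : Real.log y ≠ 0 := by linarith
  rw [iterLogDensity, abs_of_neg (by linarith : Real.log y < 0), Real.log_neg_eq_log]
  rw [Real.log_abs] at hpos
  rw [show 1 - γ - 1 = -γ by ring, Real.rpow_neg hpos.le]
  have := (Real.rpow_pos_of_pos hpos γ).ne'
  field_simp
  ring

lemma iterLogPrimitive_zero {γ : ℝ} (hγ : 1 < γ) : iterLogPrimitive γ 0 = 0 := by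
  simp [iterLogPrimitive, Real.zero_rpow (by linarith : 1 - γ ≠ 0)]

lemma continuousOn_iterLogPrimitive {γ r : ℝ} (hγ : 1 < γ) (hr : r ≤ Real.exp (-2)) :
    ContinuousOn (iterLogPrimitive γ) (Icc 0 r) := by
  intro y hy
  rcases hy.1.eq_or_lt with rfl | hpos
  · have hIoi : Tendsto (iterLogPrimitive γ) (𝓝[>] 0) (𝓝 (iterLogPrimitive γ 0)) := by
      have h := ((tendsto_rpow_neg_atTop (by linarith : 0 < γ - 1)).comp
        (Real.tendsto_log_atTop.comp
          (tendsto_abs_atBot_atTop.comp Real.tendsto_log_nhdsGT_zero))).div_const (γ - 1)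
      rw [iterLogPrimitive_zero hγ]
      unfold iterLogPrimitive
      simpa [Function.comp_def] using h
    have hIci : ContinuousWithinAt (iterLogPrimitive γ) (Ici 0) 0 :=
      continuousWithinAt_Ioi_iff_Ici.1 hIoi
    exact hIci.mono fun z hz => hz.1
  · exact (hasDerivAt_iterLogPrimitive hγ hpos (hy.2.trans hr)).continuousAt.continuousWithinAt

lemma integrableOn_iterLogDensity {γ r : ℝ} (hγ : 1 < γ) (hr : r ≤ Real.exp (-2)) :
    IntegrableOn (iterLogDensity γ) (Ioc 0 r) := by
  refine intervalIntegral.integrableOn_deriv_of_nonneg (continuousOn_iterLogPrimitive hγ hr)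
    (fun y hy => hasDerivAt_iterLogPrimitive hγ hy.1 (hy.2.le.trans hr)) fun y hy => ?_
  have hy0 : 0 < y := hy.1
  have := log_abs_log_pos hy0 (hy.2.le.trans hr)
  unfold iterLogDensity
  positivity

lemma integral_iterLogDensity {γ r : ℝ} (hγ : 1 < γ) (hr0 : 0 ≤ r) (hr : r ≤ Real.exp (-2)) :
    ∫ y in Ioc 0 r, iterLogDensity γ y = iterLogPrimitive γ r := by
  rw [← intervalIntegral.integral_of_le hr0,
    intervalIntegral.integral_eq_sub_of_hasDerivAt_of_le hr0
      (continuousOn_iterLogPrimitive hγ hr)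
      (fun y hy => hasDerivAt_iterLogPrimitive hγ hy.1 (hy.2.le.trans hr))
      ((intervalIntegrable_iff_integrableOn_Ioc_of_le hr0).2
        (integrableOn_iterLogDensity hγ hr)),
    iterLogPrimitive_zero hγ, sub_zero]

/-- The function of `|x|` whose value is `BsTwo γ b₀ x`. -/
def BsTwoRadial (γ b₀ y : ℝ) : ℝ :=
  if 0 < y ∧ y ≤ Real.exp (-2) then
    b₀ / (y ^ 2 * |Real.log y| * Real.log |Real.log y| ^ γ)
  else 0

lemma mul_BsTwoRadial {γ b₀ y : ℝ} :
    y * BsTwoRadial γ b₀ y =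
      (Ioc 0 (Real.exp (-2))).indicator (fun z => b₀ * iterLogDensity γ z) y := by
  by_cases hy : 0 < y ∧ y ≤ Real.exp (-2)
  · have hy0 : y ≠ 0 := hy.1.ne'
    rw [indicator_of_mem (show y ∈ Ioc 0 (Real.exp (-2)) from hy), BsTwoRadial, if_pos hy,
      iterLogDensity]
    rw [mul_one_div, pow_two, mul_assoc, mul_assoc, mul_assoc, ← mul_div_assoc,
      mul_div_mul_left _ _ hy0]
  · rw [indicator_of_notMem (show y ∉ Ioc 0 (Real.exp (-2)) from hy), BsTwoRadial, if_neg hy,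
      mul_zero]

lemma integrable_BsTwo {γ : ℝ} (b₀ : ℝ) (hγ : 1 < γ) : Integrable (BsTwo γ b₀) volume := by
  change Integrable (fun x : E2 => BsTwoRadial γ b₀ ‖x‖) volume
  rw [integrable_fun_norm_addHaar]
  simp only [finrank_euclideanSpace, Fintype.card_fin, Nat.add_one_sub_one, pow_one, smul_eq_mul,
    mul_BsTwoRadial]
  exact (IntegrableOn.integrable_indicator
    ((integrableOn_iterLogDensity hγ le_rfl).const_mul b₀) measurableSet_Ioc).integrableOn

lemma setIntegral_ball_BsTwo {γ r : ℝ} (b₀ : ℝ) (hγ : 1 < γ) (hr0 : 0 < r)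
    (hr : r ≤ Real.exp (-2)) :
    ∫ x in Metric.ball (0 : E2) r, BsTwo γ b₀ x = 2 * π * b₀ * iterLogPrimitive γ r := by
  have hball : ∀ x : E2, (Metric.ball (0 : E2) r).indicator (BsTwo γ b₀) x =
      (Iio r).indicator (BsTwoRadial γ b₀) ‖x‖ := by
    intro x
    by_cases hx : ‖x‖ < r
    · rw [indicator_of_mem (mem_ball_zero_iff.2 hx), indicator_of_mem (mem_Iio.2 hx)]
      rfl
    · rw [indicator_of_notMem (mt mem_ball_zero_iff.1 hx), indicator_of_notMem (mt mem_Iio.1 hx)]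
  have hweight : ∀ y : ℝ, y * (Iio r).indicator (BsTwoRadial γ b₀) y =
      (Ioo 0 r).indicator (fun z => b₀ * iterLogDensity γ z) y := by
    intro y
    rw [← indicator_mul_right (Iio r) (fun z => z)]
    simp only [mul_BsTwoRadial]
    rw [indicator_indicator]
    congr 1
    ext z
    simp only [mem_inter_iff, mem_Iio, mem_Ioc, mem_Ioo]
    exact ⟨fun h => ⟨h.2.1, h.1⟩, fun h => ⟨h.2, h.1, h.2.le.trans hr⟩⟩
  rw [← integral_indicator Metric.isOpen_ball.measurableSet]
  simp only [hball]
  rw [integral_fun_norm_addHaar]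
  simp only [finrank_euclideanSpace, Fintype.card_fin, Nat.add_one_sub_one, pow_one, smul_eq_mul,
    hweight]
  rw [setIntegral_indicator measurableSet_Ioo, inter_eq_right.2 (fun z hz => hz.1),
    ← integral_Ioc_eq_integral_Ioo, integral_const_mul, integral_iterLogDensity hγ hr0.le hr,
    Measure.real, EuclideanSpace.volume_ball_fin_two]
  simp [Real.pi_nonneg]
  ring

/-- **Example 2.** For `γ > 1` the field `B_s` is in `L¹(ℝ²)` and its flux through the
ball of radius `r ≤ e⁻²` equals `(2π b₀/(γ−1)) (log|log r|)^{1−γ}`. -/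
theorem example_two (γ b₀ : ℝ) (hγ : 1 < γ) :
    Integrable (BsTwo γ b₀) volume ∧
    (∀ r : ℝ, 0 < r → r ≤ Real.exp (-2) →
      ∫ x in Metric.ball (0 : E2) r, BsTwo γ b₀ x
        = (2 * π * b₀ / (γ - 1)) * Real.log |Real.log r| ^ (1 - γ)) := by
  refine ⟨integrable_BsTwo b₀ hγ, fun r hr0 hr => ?_⟩
  rw [setIntegral_ball_BsTwo b₀ hγ hr0 hr, iterLogPrimitive]
  ring

end
end

section
/- Let a > 1. (i) For every measurable V : ℝ² → ℝ and every λ > 0 one has [λV]_a = λ [V]_a. (ii) For σ > 1 let V_σ(x) = |x|^{−2} |log|x||^{−2} ( log|log|x|| )^{−1/σ} for 0 < |x| < e^{−2} and V_σ(x) = 0 otherwise. Then [V_σ]_a < ∞ if and only if σ ≤ a. -/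
open MeasureTheory Real Filter Set
open scoped ENNReal Topology

noncomputable section

/-- The point of `ℝ²` with polar coordinates `(r, θ)`. -/
def polarPt (r θ : ℝ) : E2 := mk2 (r * Real.cos θ) (r * Real.sin θ)

/-- `𝒱(r) = ess sup_{0 ≤ θ < 2π} V₊(r cos θ, r sin θ)`, valued in `ℝ≥0∞`. -/
def calV (V : E2 → ℝ) (r : ℝ) : ℝ≥0∞ :=
  essSup (fun θ : ℝ => ENNReal.ofReal (V (polarPt r θ)))
    (volume.restrict (Set.Ico 0 (2 * π)))

/-- The radial weight `ρ₀(r) = 1/(r²(1 + (log r)²))`. -/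
def rho0r (r : ℝ) : ℝ := 1 / (r ^ 2 * (1 + Real.log r ^ 2))

/-- The level set `Ω_t = {r > 0 : 𝒱(r) > t ρ₀(r)}`. -/
def OmegaSet (V : E2 → ℝ) (t : ℝ) : Set ℝ :=
  {r : ℝ | 0 < r ∧ ENNReal.ofReal (t * rho0r r) < calV V r}

/-- The functional `[V]_a = (sup_{t>0} t^a ∫_{Ω_t} ρ₀(r)(1 + |log r|) r dr)^{1/a}`. -/
def VAnorm (V : E2 → ℝ) (a : ℝ) : ℝ≥0∞ :=
  (⨆ t ∈ Set.Ioi (0:ℝ), ENNReal.ofReal (t ^ a) *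
      ∫⁻ r in OmegaSet V t, ENNReal.ofReal (rho0r r * (1 + |Real.log r|) * r)) ^ (1 / a)

/-- The singular potential
`V_σ(x) = |x|^{−2}|log|x||^{−2}(log|log|x||)^{−1/σ}` for `0 < |x| < e⁻²`. -/
def Vsigma (σ : ℝ) (x : E2) : ℝ :=
  if 0 < ‖x‖ ∧ ‖x‖ < Real.exp (-2) then
    ‖x‖ ^ (-2 : ℝ) * |Real.log ‖x‖| ^ (-2 : ℝ) * Real.log |Real.log ‖x‖| ^ (-1 / σ)
  else 0

theorem calV_const_mul (V : E2 → ℝ) {lam : ℝ} (hl : 0 < lam) (r : ℝ) :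
    calV (fun x => lam * V x) r = ENNReal.ofReal lam * calV V r := by
  simp only [calV, ENNReal.ofReal_mul hl.le]
  exact ENNReal.essSup_const_mul

theorem OmegaSet_const_mul (V : E2 → ℝ) {lam : ℝ} (hl : 0 < lam) (t : ℝ) :
    OmegaSet (fun x => lam * V x) (lam * t) = OmegaSet V t := by
  ext r
  simp only [OmegaSet, mem_ofPred_eq, calV_const_mul V hl, mul_assoc, ENNReal.ofReal_mul hl.le]
  rw [ENNReal.mul_lt_mul_iff_right (by simpa using hl) ENNReal.ofReal_ne_top]

theorem VAnorm_const_mul (V : E2 → ℝ) {a lam : ℝ} (ha : 0 < a) (hl : 0 < lam) :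
    VAnorm (fun x => lam * V x) a = ENNReal.ofReal lam * VAnorm V a := by
  have key : ∀ t : ℝ, 0 < t → ENNReal.ofReal ((lam * t) ^ a) *
        ∫⁻ r in OmegaSet (fun x => lam * V x) (lam * t),
          ENNReal.ofReal (rho0r r * (1 + |Real.log r|) * r) =
      ENNReal.ofReal (lam ^ a) * (ENNReal.ofReal (t ^ a) *
        ∫⁻ r in OmegaSet V t, ENNReal.ofReal (rho0r r * (1 + |Real.log r|) * r)) := by
    intro t ht
    rw [OmegaSet_const_mul V hl, Real.mul_rpow hl.le ht.le,
      ENNReal.ofReal_mul (by positivity), mul_assoc]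
  have hroot : ENNReal.ofReal lam = ENNReal.ofReal (lam ^ a) ^ (1 / a) := by
    rw [ENNReal.ofReal_rpow_of_pos (by positivity), ← Real.rpow_mul hl.le,
      mul_one_div_cancel ha.ne', Real.rpow_one]
  rw [VAnorm, VAnorm, hroot, ← ENNReal.mul_rpow_of_nonneg _ _ (by positivity)]
  congr 1
  simp only [ENNReal.mul_iSup]
  apply le_antisymm
  · refine iSup₂_le fun t ht => ?_
    have ht' : 0 < t / lam := div_pos ht hl
    refine le_trans (le_of_eq ?_) (le_iSup₂ (t / lam) ht')
    rw [← key _ ht', mul_div_cancel₀ _ hl.ne']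
  · refine iSup₂_le fun t ht => ?_
    rw [← key t ht]
    exact le_iSup₂ (f := fun (s : ℝ) (_ : s ∈ Ioi (0 : ℝ)) => ENNReal.ofReal (s ^ a) *
      ∫⁻ r in OmegaSet (fun x => lam * V x) s,
        ENNReal.ofReal (rho0r r * (1 + |Real.log r|) * r)) (lam * t) (mul_pos hl ht)

theorem norm_polarPt {r : ℝ} (hr : 0 ≤ r) (θ : ℝ) : ‖polarPt r θ‖ = r := by
  rw [EuclideanSpace.norm_eq]
  simp only [polarPt, mk2, WithLp.equiv_symm_apply, Fin.sum_univ_two, Real.norm_eq_abs, sq_abs,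
    Matrix.cons_val_zero, Matrix.cons_val_one]
  rw [show (r * cos θ) ^ 2 + (r * sin θ) ^ 2 = r ^ 2 * (sin θ ^ 2 + cos θ ^ 2) by ring,
    sin_sq_add_cos_sq, mul_one, Real.sqrt_sq hr]

theorem calV_of_radial (f : ℝ → ℝ) {r : ℝ} (hr : 0 ≤ r) :
    calV (fun x => f ‖x‖) r = ENNReal.ofReal (f r) := by
  simp only [calV, norm_polarPt hr]
  refine essSup_const _ fun h => ?_
  rw [Measure.restrict_eq_zero, Real.volume_Ico, ENNReal.ofReal_eq_zero] at h
  linarith [Real.pi_pos]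

theorem two_lt_neg_log {r : ℝ} (hr : 0 < r) (h : r < Real.exp (-2)) : 2 < -Real.log r := by
  linarith [(Real.log_lt_iff_lt_exp hr).2 h]

theorem mem_OmegaSet_Vsigma {σ t r : ℝ} (ht : 0 < t) :
    r ∈ OmegaSet (Vsigma σ) t ↔ 0 < r ∧ r < Real.exp (-2) ∧
      t * (Real.log r ^ 2 / (1 + Real.log r ^ 2)) <
        Real.log (-Real.log r) ^ (-1 / σ) := by
  have hcal : ∀ r : ℝ, 0 < r → calV (Vsigma σ) r = _ := fun r hr => calV_of_radial
    (fun s => if 0 < s ∧ s < Real.exp (-2) then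
      s ^ (-2 : ℝ) * |Real.log s| ^ (-2 : ℝ) * Real.log |Real.log s| ^ (-1 / σ) else 0) hr.le
  rw [OmegaSet, mem_ofPred_eq]
  refine and_congr_right fun hr => ?_
  rw [hcal r hr]
  have hρ : 0 < rho0r r := by unfold rho0r; positivity
  rw [ENNReal.ofReal_lt_ofReal_iff_of_nonneg (by positivity)]
  by_cases h : r < Real.exp (-2)
  · have hL := two_lt_neg_log hr h
    have habs : |Real.log r| = -Real.log r := abs_of_neg (by linarith)
    have h2 : ∀ x : ℝ, 0 < x → x ^ (-2 : ℝ) = (x ^ 2)⁻¹ := fun x hx => by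
      rw [Real.rpow_neg hx.le, Real.rpow_two]
    have hl : Real.log r ≠ 0 := (abs_pos.1 (by linarith))
    simp only [hr, h, and_self, if_true, true_and, habs]
    rw [h2 r hr, h2 _ (by linarith), neg_sq, rho0r]
    rw [← mul_lt_mul_iff_right₀ (show 0 < r ^ 2 * Real.log r ^ 2 by positivity)]
    refine iff_of_eq (congrArg₂ _ ?_ ?_)
    · field_simp
    · field_simp
  · simp only [h, and_false, if_false, false_and, iff_false, not_lt]
    positivity

theorem lintegral_inv_mul_neg_log (M : ℝ) :
    ∫⁻ r in Ioo (Real.exp (-Real.exp M)) (Real.exp (-2)),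
      ENNReal.ofReal ((r * (-Real.log r))⁻¹) = ENNReal.ofReal (M - Real.log 2) := by
  rcases lt_or_ge M (Real.log 2) with hM | hM
  · have h2 : Real.exp M < 2 := (Real.lt_log_iff_exp_lt (by norm_num)).1 hM
    rw [Ioo_eq_empty (by rw [not_lt, Real.exp_le_exp]; linarith),
      ENNReal.ofReal_of_nonpos (by linarith)]
    simp
  have h2 : 2 ≤ Real.exp M := (Real.log_le_iff_le_exp (by norm_num)).1 hM
  have hle : Real.exp (-Real.exp M) ≤ Real.exp (-2) := Real.exp_le_exp.2 (by linarith)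
  have hmem : ∀ r ∈ Icc (Real.exp (-Real.exp M)) (Real.exp (-2)),
      0 < r ∧ 0 < -Real.log r := fun r hr => by
    have h0 : 0 < r := (Real.exp_pos _).trans_le hr.1
    exact ⟨h0, by linarith [(Real.log_le_iff_le_exp h0).2 hr.2]⟩
  have hcont : ContinuousOn (fun r : ℝ => (r * (-Real.log r))⁻¹)
      (Icc (Real.exp (-Real.exp M)) (Real.exp (-2))) := by
    refine ContinuousOn.inv₀ (continuousOn_id.mul (ContinuousOn.neg
      (continuousOn_id.log fun r hr => (hmem r hr).1.ne'))) fun r hr => ?_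
    exact (mul_pos (hmem r hr).1 (hmem r hr).2).ne'
  have h_intervalIntegrable : IntervalIntegrable (fun r : ℝ => (r * (-Real.log r))⁻¹) volume
      (Real.exp (-Real.exp M)) (Real.exp (-2)) := by
    apply ContinuousOn.intervalIntegrable
    rwa [uIcc_of_le hle]
  have hftc := intervalIntegral.integral_eq_sub_of_hasDerivAt
    (f := fun r : ℝ => -Real.log (-Real.log r)) (fun r hr => by
      rw [uIcc_of_le hle] at hr
      obtain ⟨h0, h1⟩ := hmem r hr
      have hd : HasDerivAt (fun r : ℝ => -Real.log (-Real.log r))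
          (-(-r⁻¹ / (-Real.log r))) r := (((Real.hasDerivAt_log h0.ne').neg).log h1.ne').neg
      rwa [neg_div, neg_neg, div_eq_mul_inv, ← mul_inv] at hd) h_intervalIntegrable
  rw [← ofReal_integral_eq_lintegral_ofReal]
  · rw [← integral_Ioc_eq_integral_Ioo, ← intervalIntegral.integral_of_le hle, hftc]
    simp only [Real.log_exp, neg_neg]
    congr 1
    ring
  · exact (hcont.integrableOn_Icc).mono_set Ioo_subset_Icc_self
  · refine (ae_restrict_mem measurableSet_Ioo).mono fun r hr => ?_
    obtain ⟨h0, h1⟩ := hmem r (Ioo_subset_Icc_self hr)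
    exact (inv_pos.2 (mul_pos h0 h1)).le

theorem weight_bounds {r : ℝ} (hr : 0 < r) (h : r < Real.exp (-2)) :
    (r * (-Real.log r))⁻¹ ≤ rho0r r * (1 + |Real.log r|) * r ∧
      rho0r r * (1 + |Real.log r|) * r ≤ 2 * (r * (-Real.log r))⁻¹ := by
  have hL := two_lt_neg_log hr h
  rw [abs_of_neg (by linarith : Real.log r < 0), rho0r]
  generalize Real.log r = l at *
  obtain ⟨L, rfl⟩ : ∃ L, l = -L := ⟨-l, by ring⟩
  rw [neg_neg] at *
  have e : 1 / (r ^ 2 * (1 + (-L) ^ 2)) * (1 + L) * r = (1 + L) / (r * (1 + L ^ 2)) := by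
    field_simp
  rw [e]
  constructor
  · rw [inv_eq_one_div, div_le_div_iff₀ (by positivity) (by positivity)]
    nlinarith [mul_pos hr (show 0 < L by linarith)]
  · rw [← div_eq_mul_inv, div_le_div_iff₀ (by positivity) (by positivity)]
    nlinarith [mul_pos hr (show 0 < L by linarith), mul_pos hr (show 0 < L ^ 2 by positivity),
      mul_nonneg hr.le (sq_nonneg (L - 1))]

theorem mem_Ioo_exp_iff {r M : ℝ} (hr : 0 < r) (h : r < Real.exp (-2)) :
    r ∈ Ioo (Real.exp (-Real.exp M)) (Real.exp (-2)) ↔ Real.log (-Real.log r) < M := by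
  have hL := two_lt_neg_log hr h
  rw [mem_Ioo, and_iff_left h, ← Real.lt_log_iff_exp_lt hr,
    Real.log_lt_iff_lt_exp (by linarith)]
  exact neg_lt

theorem lt_rpow_neg_one_div_iff {s y σ : ℝ} (hs : 0 < s) (hy : 0 < y) (hσ : 0 < σ) :
    s < y ^ (-1 / σ) ↔ y < s⁻¹ ^ σ := by
  rw [neg_div, Real.rpow_neg hy.le, lt_inv_comm₀ hs (by positivity), one_div,
    Real.rpow_inv_lt_iff_of_pos hy.le (by positivity) hσ]

theorem OmegaSet_Vsigma_subset {σ t : ℝ} (hσ : 0 < σ) (ht : 0 < t) :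
    OmegaSet (Vsigma σ) t ⊆ Ioo (Real.exp (-Real.exp ((t / 2)⁻¹ ^ σ))) (Real.exp (-2)) := by
  intro r hr
  obtain ⟨h0, h, hlt⟩ := (mem_OmegaSet_Vsigma ht).1 hr
  have hL := two_lt_neg_log h0 h
  rw [mem_Ioo_exp_iff h0 h, ← lt_rpow_neg_one_div_iff (by positivity)
    (Real.log_pos (by linarith)) hσ]
  refine lt_of_le_of_lt ?_ hlt
  have : 1 / 2 ≤ Real.log r ^ 2 / (1 + Real.log r ^ 2) := by
    rw [div_le_div_iff₀ (by norm_num) (by positivity)]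
    nlinarith
  nlinarith

theorem subset_OmegaSet_Vsigma {σ t : ℝ} (hσ : 0 < σ) (ht : 0 < t) :
    Ioo (Real.exp (-Real.exp (t⁻¹ ^ σ))) (Real.exp (-2)) ⊆ OmegaSet (Vsigma σ) t := by
  intro r hr
  have h0 : 0 < r := (Real.exp_pos _).trans hr.1
  have hL := two_lt_neg_log h0 hr.2
  refine (mem_OmegaSet_Vsigma ht).2 ⟨h0, hr.2, ?_⟩
  rw [mem_Ioo_exp_iff h0 hr.2, ← lt_rpow_neg_one_div_iff ht
    (Real.log_pos (by linarith)) hσ] at hr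
  refine lt_of_le_of_lt (mul_le_of_le_one_right ht.le ?_) hr
  rw [div_le_one (by positivity)]
  linarith

theorem lintegral_OmegaSet_Vsigma_le {σ t : ℝ} (hσ : 0 < σ) (ht : 0 < t) :
    ∫⁻ r in OmegaSet (Vsigma σ) t, ENNReal.ofReal (rho0r r * (1 + |Real.log r|) * r) ≤
      ENNReal.ofReal (2 * ((t / 2)⁻¹ ^ σ - Real.log 2)) := by
  refine (lintegral_mono_set (OmegaSet_Vsigma_subset hσ ht)).trans ?_
  rw [ENNReal.ofReal_mul two_pos.le, ← lintegral_inv_mul_neg_log,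
    ← lintegral_const_mul' _ _ ENNReal.ofReal_ne_top]
  refine setLIntegral_mono' measurableSet_Ioo fun r hr => ?_
  rw [← ENNReal.ofReal_mul two_pos.le]
  exact ENNReal.ofReal_le_ofReal (weight_bounds ((Real.exp_pos _).trans hr.1) hr.2).2

theorem le_lintegral_OmegaSet_Vsigma {σ t : ℝ} (hσ : 0 < σ) (ht : 0 < t) :
    ENNReal.ofReal (t⁻¹ ^ σ - Real.log 2) ≤
      ∫⁻ r in OmegaSet (Vsigma σ) t, ENNReal.ofReal (rho0r r * (1 + |Real.log r|) * r) := by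
  refine le_trans ?_ (lintegral_mono_set (subset_OmegaSet_Vsigma hσ ht))
  rw [← lintegral_inv_mul_neg_log]
  refine setLIntegral_mono' measurableSet_Ioo fun r hr => ?_
  exact ENNReal.ofReal_le_ofReal (weight_bounds ((Real.exp_pos _).trans hr.1) hr.2).1

theorem rpow_mul_sub_log_le {a σ t : ℝ} (hσ : 0 < σ) (hσa : σ ≤ a) (ht : 0 < t) :
    t ^ a * (2 * ((t / 2)⁻¹ ^ σ - Real.log 2)) ≤
      2 ^ a * (2 * Real.log 2 ^ ((σ - a) / σ)) := by
  have hlog : 0 < Real.log 2 := Real.log_pos one_lt_two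
  obtain ⟨s, hs, rfl⟩ : ∃ s : ℝ, 0 < s ∧ t = 2 * s⁻¹ :=
    ⟨2 / t, by positivity, by field_simp⟩
  rw [mul_div_cancel_left₀ _ two_ne_zero, inv_inv, Real.mul_rpow two_pos.le (by positivity),
    mul_assoc]
  refine mul_le_mul_of_nonneg_left ?_ (by positivity)
  rcases le_or_gt (s ^ σ) (Real.log 2) with h | h
  · exact (mul_nonpos_of_nonneg_of_nonpos (by positivity) (by linarith)).trans (by positivity)
  · have h1 : s ^ (σ - a) ≤ Real.log 2 ^ ((σ - a) / σ) := by
      have := Real.rpow_le_rpow_of_nonpos hlog h.le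
        (div_nonpos_of_nonpos_of_nonneg (by linarith : σ - a ≤ 0) hσ.le)
      rwa [← Real.rpow_mul hs.le, mul_div_cancel₀ _ hσ.ne'] at this
    have h2 : s⁻¹ ^ a * s ^ σ = s ^ (σ - a) := by
      rw [Real.inv_rpow hs.le, Real.rpow_sub hs]
      ring
    have h3 : 0 ≤ s⁻¹ ^ a * Real.log 2 := by positivity
    nlinarith

theorem tendsto_rpow_neg_mul_sub_log {a σ : ℝ} (ha : 0 < a) (h : a < σ) :
    Tendsto (fun s : ℝ => s⁻¹ ^ a * (s ^ σ - Real.log 2)) atTop atTop := by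
  refine tendsto_atTop_mono' _ ?_ (tendsto_atTop_add_const_right _ (-Real.log 2)
    (tendsto_rpow_atTop (sub_pos.2 h)))
  filter_upwards [eventually_ge_atTop 1] with s hs
  have hs0 : 0 < s := by linarith
  have h1 : s⁻¹ ^ a ≤ 1 := Real.rpow_le_one (by positivity) (inv_le_one_of_one_le₀ hs) ha.le
  have h2 : s⁻¹ ^ a * s ^ σ = s ^ (σ - a) := by
    rw [Real.inv_rpow hs0.le, Real.rpow_sub hs0]
    ring
  nlinarith [Real.log_pos one_lt_two]

theorem VAnorm_lt_top_iff (V : E2 → ℝ) {a : ℝ} (ha : 0 < a) :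
    VAnorm V a < ⊤ ↔ (⨆ t ∈ Ioi (0 : ℝ), ENNReal.ofReal (t ^ a) *
      ∫⁻ r in OmegaSet V t, ENNReal.ofReal (rho0r r * (1 + |Real.log r|) * r)) < ⊤ :=
  ENNReal.rpow_lt_top_iff_of_pos (by positivity)

/-- **Properties of `[·]_a`.** (i) `[λV]_a = λ[V]_a` for `λ > 0`;
(ii) for `σ > 1`, `[V_σ]_a < ∞` if and only if `σ ≤ a`. -/
theorem VAnorm_properties (a : ℝ) (ha : 1 < a) :
    (∀ (V : E2 → ℝ) (lam : ℝ), 0 < lam →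
      VAnorm (fun x => lam * V x) a = ENNReal.ofReal lam * VAnorm V a) ∧
    (∀ σ : ℝ, 1 < σ → (VAnorm (Vsigma σ) a < ⊤ ↔ σ ≤ a)) := by
  have ha0 : 0 < a := by linarith
  refine ⟨fun V lam hl => VAnorm_const_mul V ha0 hl, fun σ hσ => ?_⟩
  have hσ0 : 0 < σ := by linarith
  rw [VAnorm_lt_top_iff _ ha0]
  constructor
  · contrapose!
    intro h
    rw [top_le_iff]
    refine ENNReal.eq_top_of_forall_nnreal_le fun C => ?_
    obtain ⟨s, hsC, hs⟩ := (((tendsto_rpow_neg_mul_sub_log ha0 h).eventually_ge_atTop C).and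
      (eventually_gt_atTop 0)).exists
    refine le_trans ?_ (le_iSup₂ s⁻¹ (inv_pos.2 hs))
    refine le_trans ?_ (mul_le_mul_right (le_lintegral_OmegaSet_Vsigma hσ0 (inv_pos.2 hs)) _)
    rw [← ENNReal.ofReal_mul (by positivity), inv_inv, ← ENNReal.ofReal_coe_nnreal]
    exact ENNReal.ofReal_le_ofReal hsC
  · intro h
    refine lt_of_le_of_lt (iSup₂_le fun t ht => ?_)
      (ENNReal.ofReal_lt_top (r := 2 ^ a * (2 * Real.log 2 ^ ((σ - a) / σ))))
    have ht0 : 0 < t := ht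
    refine (mul_le_mul_right (lintegral_OmegaSet_Vsigma_le hσ0 ht0) _).trans ?_
    rw [← ENNReal.ofReal_mul (by positivity)]
    exact ENNReal.ofReal_le_ofReal (rpow_mul_sub_log_le hσ0 h ht0)

end
end
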